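/- arXiv:0707.3862 — 8 statements merged into one kernel-verified Lean document; each statement's English description precedes it below -/
import Mathlib

section
/- Let p be an even positive integer and m an odd positive integer. Set s = mp − 2, r = p(m−1), λ = s/2 and ν = p/2. Let A(x) = Σ_{k=0}^{p} a_k x^{p−k} be a real polynomial of degree p (a_0 ≠ 0) with no real zeros, and let B(x) = Σ_{k=0}^{p−2} b_k x^{p−2−k} be a real polynomial. Let x_1, …, x_p be the complex roots of A listed with multiplicity, and for 0 ≤ l ≤ p define e_l = a_0^m (−1)^l (Π_{j=1}^{p} Q_m(x_j)) · σ_l^{(p)}(R_m(x_1), …, R_m(x_p)); then each e_l is real. Set H(x) = Σ_{l=0}^{p} e_l x^{p−l} and E(x) = Σ_{l=0}^{p} e_l P_m(x)^{p−l} Q_m(x)^{l}; then A divides E, and we write Z = E/A = Σ_{k=0}^{r} z_k x^{r−k} and C = B·Z = Σ_{k=0}^{s} c_k x^{s−k}. For indices j, α, β, γ define M_1(j,α,β;γ) = (−1)^{j+α−β} c_{2j} · (2^{2(α−β)} α/(2α−β)) · binom(2α−β, β) · binom(ν−α−1+β, γ) · [T_{λ+αm}(2j, s−2j) + T_{λ−αm}(2j,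 s−2j)] and M_2(j,α,β;γ) = (−1)^{j+β} c_{2j+1} · 2^{2β+1} · binom(α+β, 2β+1) · binom(ν−2−β, γ) · [T_{λ+αm}(2j+1, s−2j−1) − T_{λ−αm}(2j+1, s−2j−1)]. Define the polynomial J(x) = 2^{−s} { Σ_{γ=0}^{ν−1} ( binom(ν−1, γ) Σ_{j=0}^{λ} (−1)^j c_{2j} T_{λ}(2j, s−2j) ) x^{2γ} + Σ_{γ=0}^{ν−2} ( Σ_{j=0}^{λ} Σ_{α=1}^{ν−1−γ} Σ_{β=0}^{α} M_1(j,α,β;γ) ) x^{2γ} + Σ_{γ=1}^{ν−1} ( Σ_{j=0}^{λ} Σ_{α=ν−γ}^{ν−1} Σ_{β=α−ν+γ+1}^{α} M_1(j,α,β;γ) ) x^{2γ} + Σ_{γ=0}^{ν−2} ( Σ_{j=0}^{λ−1} Σ_{α=1}^{ν−1−γ} Σ_{β=0}^{α−1} M_2(j,α,β;γ) ) x^{2γ+1} + Σ_{γ=1}^{ν−2} ( Σ_{j=0}^{λ−1} Σ_{α=ν−γ}^{ν−1} Σ_{β=0}^{α−1} M_2(j,α,β;γ) ) x^{2γ+1}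 }. Then ∫_{−∞}^{∞} B(x)/A(x) dx = ∫_{−∞}^{∞} J(x)/H(x) dx. -/
open Polynomial

/-! Definitions for the rational Landen transformation of
`∫_{−∞}^{∞} B(x)/A(x) dx`, with `p` even, `m` odd. -/

/-- The polynomial `P_m(x) = Σ_{j=0}^{⌊m/2⌋} (−1)^j C(m,2j) x^{m−2j}` in `ℝ[x]`. -/
noncomputable def Ppoly (m : ℕ) : Polynomial ℝ :=
  ∑ j ∈ Finset.range (m / 2 + 1),
    Polynomial.C ((-1 : ℝ) ^ j * (m.choose (2 * j))) * Polynomial.X ^ (m - 2 * j)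

/-- The polynomial `Q_m(x) = Σ_{j=0}^{⌊(m−1)/2⌋} (−1)^j C(m,2j+1) x^{m−2j−1}` in `ℝ[x]`. -/
noncomputable def Qpoly (m : ℕ) : Polynomial ℝ :=
  ∑ j ∈ Finset.range ((m - 1) / 2 + 1),
    Polynomial.C ((-1 : ℝ) ^ j * (m.choose (2 * j + 1))) * Polynomial.X ^ (m - (2 * j + 1))

/-- `P_m` in `ℂ[x]`. -/
noncomputable def PmC (m : ℕ) : Polynomial ℂ :=
  ∑ j ∈ Finset.range (m / 2 + 1),
    Polynomial.C ((-1 : ℂ) ^ j * (m.choose (2 * j))) * Polynomial.X ^ (m - 2 * j)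

/-- `Q_m` in `ℂ[x]`. -/
noncomputable def QmC (m : ℕ) : Polynomial ℂ :=
  ∑ j ∈ Finset.range ((m - 1) / 2 + 1),
    Polynomial.C ((-1 : ℂ) ^ j * (m.choose (2 * j + 1))) * Polynomial.X ^ (m - (2 * j + 1))

/-- The `l`-th elementary symmetric polynomial `σ_l^{(p)}(y_1, …, y_p)`. -/
noncomputable def esymmFn (p : ℕ) (y : Fin p → ℂ) (l : ℕ) : ℂ :=
  ∑ S ∈ Finset.powersetCard l (Finset.univ : Finset (Fin p)), ∏ j ∈ S, y j

/-- `e_l = a₀^m (−1)^l (Π_j Q_m(x_j)) σ_l^{(p)}(R_m(x_1), …, R_m(x_p))`; here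
`x_1, …, x_p` are the (complex) roots of `A` listed with multiplicity. -/
noncomputable def eC (m p : ℕ) (a₀ : ℝ) (x : Fin p → ℂ) (l : ℕ) : ℂ :=
  (a₀ : ℂ) ^ m * (-1) ^ l * (∏ j, (QmC m).eval (x j)) *
    esymmFn p (fun j => (PmC m).eval (x j) / (QmC m).eval (x j)) l

/-- `A(x) = Σ_{k=0}^{p} a_k x^{p−k}`. -/
noncomputable def Apoly (p : ℕ) (a : ℕ → ℝ) : Polynomial ℝ :=
  ∑ k ∈ Finset.range (p + 1), Polynomial.C (a k) * Polynomial.X ^ (p - k)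

/-- `B(x) = Σ_{k=0}^{p−2} b_k x^{p−2−k}`. -/
noncomputable def Bpoly (p : ℕ) (b : ℕ → ℝ) : Polynomial ℝ :=
  ∑ k ∈ Finset.range (p - 1), Polynomial.C (b k) * Polynomial.X ^ (p - 2 - k)

/-- The new denominator `H(x) = Σ_{l=0}^{p} e_l x^{p−l}` (the `e_l` are real). -/
noncomputable def Hpoly (m p : ℕ) (a₀ : ℝ) (x : Fin p → ℂ) : Polynomial ℝ :=
  ∑ l ∈ Finset.range (p + 1),
    Polynomial.C ((eC m p a₀ x l).re) * Polynomial.X ^ (p - l)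

/-- `E(x) = Σ_{l=0}^{p} e_l P_m(x)^{p−l} Q_m(x)^{l}`, as a real polynomial. -/
noncomputable def EpolyR (m p : ℕ) (a₀ : ℝ) (x : Fin p → ℂ) : Polynomial ℝ :=
  ∑ l ∈ Finset.range (p + 1),
    Polynomial.C ((eC m p a₀ x l).re) * (Ppoly m) ^ (p - l) * (Qpoly m) ^ l

/-- `T_x(a,b) = Σ_{j=0}^{x} (−1)^{a−x+j} C(a, x−j) C(b, j)` (sign exponent in `ℤ`,
`C(n,k) = 0` outside `0 ≤ k ≤ n`). -/
noncomputable def T (x a b : ℕ) : ℝ :=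
  ∑ j ∈ Finset.range (x + 1),
    (-1 : ℝ) ^ ((a : ℤ) - (x : ℤ) + (j : ℤ)) * (a.choose (x - j)) * (b.choose j)

/-- `M₁(j,α,β;γ)`, with `s = mp−2`, `λ = s/2`, `ν = p/2`. -/
noncomputable def M1 (m p : ℕ) (c : ℕ → ℝ) (γ j α β : ℕ) : ℝ :=
  (-1 : ℝ) ^ (j + (α - β)) * c (2 * j) *
    (2 ^ (2 * (α - β)) * (α : ℝ) / ((2 * α - β : ℕ) : ℝ)) *
    ((2 * α - β).choose β) * ((p / 2 - α - 1 + β).choose γ) *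
    (T ((m * p - 2) / 2 + α * m) (2 * j) (m * p - 2 - 2 * j) +
     T ((m * p - 2) / 2 - α * m) (2 * j) (m * p - 2 - 2 * j))

/-- `M₂(j,α,β;γ)`, with `s = mp−2`, `λ = s/2`, `ν = p/2`. -/
noncomputable def M2 (m p : ℕ) (c : ℕ → ℝ) (γ j α β : ℕ) : ℝ :=
  (-1 : ℝ) ^ (j + β) * c (2 * j + 1) * 2 ^ (2 * β + 1) *
    ((α + β).choose (2 * β + 1)) * ((p / 2 - 2 - β).choose γ) *
    (T ((m * p - 2) / 2 + α * m) (2 * j + 1) (m * p - 2 - (2 * j + 1)) -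
     T ((m * p - 2) / 2 - α * m) (2 * j + 1) (m * p - 2 - (2 * j + 1)))

/-- The new numerator `J`, built from the coefficients `c_k` of `C = B·Z`. -/
noncomputable def Jfun (m p : ℕ) (c : ℕ → ℝ) (t : ℝ) : ℝ :=
  (1 / 2 ^ (m * p - 2)) *
    ((∑ γ ∈ Finset.range (p / 2),
        ((((p / 2 - 1).choose γ : ℝ)) *
          ∑ j ∈ Finset.range ((m * p - 2) / 2 + 1),
            (-1 : ℝ) ^ j * c (2 * j) * T ((m * p - 2) / 2) (2 * j) (m * p - 2 - 2 * j)) *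
          t ^ (2 * γ)) +
     (∑ γ ∈ Finset.range (p / 2 - 1),
        (∑ j ∈ Finset.range ((m * p - 2) / 2 + 1),
          ∑ α ∈ Finset.Icc 1 (p / 2 - 1 - γ),
            ∑ β ∈ Finset.range (α + 1), M1 m p c γ j α β) * t ^ (2 * γ)) +
     (∑ γ ∈ Finset.Icc 1 (p / 2 - 1),
        (∑ j ∈ Finset.range ((m * p - 2) / 2 + 1),
          ∑ α ∈ Finset.Icc (p / 2 - γ) (p / 2 - 1),
            ∑ β ∈ Finset.Icc (α + γ + 1 - p / 2) α, M1 m p c γ j α β) * t ^ (2 * γ)) +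
     (∑ γ ∈ Finset.range (p / 2 - 1),
        (∑ j ∈ Finset.range ((m * p - 2) / 2),
          ∑ α ∈ Finset.Icc 1 (p / 2 - 1 - γ),
            ∑ β ∈ Finset.range α, M2 m p c γ j α β) * t ^ (2 * γ + 1)) +
     (∑ γ ∈ Finset.Icc 1 (p / 2 - 2),
        (∑ j ∈ Finset.range ((m * p - 2) / 2),
          ∑ α ∈ Finset.Icc (p / 2 - γ) (p / 2 - 1),
            ∑ β ∈ Finset.range α, M2 m p c γ j α β) * t ^ (2 * γ + 1)))

theorem Finset.sum_range_two_mul_eq {M : Type*} [AddCommMonoid M] (f : ℕ → M) (n : ℕ) :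
    ∑ k ∈ Finset.range (2 * n), f k =
      ∑ j ∈ Finset.range n, f (2 * j) + ∑ j ∈ Finset.range n, f (2 * j + 1) := by
  induction n with
  | zero => simp
  | succ n ih =>
    rw [show 2 * (n + 1) = 2 * n + 1 + 1 by ring, Finset.sum_range_succ, Finset.sum_range_succ, ih,
      Finset.sum_range_succ, Finset.sum_range_succ]
    abel

/-- The binomial expansion of `(z + w)^m` for a square root `w` of `-1`. -/
theorem add_pow_eq_PmC_add_QmC {m : ℕ} (hm : Odd m) (z w : ℂ) (hw : w ^ 2 = -1) :
    (z + w) ^ m = (PmC m).eval z + w * (QmC m).eval z := by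
  obtain ⟨q, rfl⟩ := hm
  rw [add_comm z w, add_pow, show 2 * q + 1 + 1 = 2 * (q + 1) by ring,
    Finset.sum_range_two_mul_eq, PmC, QmC, Polynomial.eval_finsetSum, Polynomial.eval_finsetSum,
    Finset.mul_sum, show (2 * q + 1) / 2 + 1 = q + 1 by omega,
    show (2 * q + 1 - 1) / 2 + 1 = q + 1 by omega]
  congr 1 <;> refine Finset.sum_congr rfl fun j _ => ?_
  · simp [pow_mul, hw]; ring
  · simp [pow_succ, pow_mul, hw]; ring

theorem map_Ppoly (m : ℕ) : (Ppoly m).map (algebraMap ℝ ℂ) = PmC m := by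
  simp [Ppoly, PmC, Polynomial.map_sum]

theorem map_Qpoly (m : ℕ) : (Qpoly m).map (algebraMap ℝ ℂ) = QmC m := by
  simp [Qpoly, QmC, Polynomial.map_sum]

theorem eval_PmC_ofReal (m : ℕ) (t : ℝ) : (PmC m).eval (t : ℂ) = ((Ppoly m).eval t : ℝ) := by
  rw [← map_Ppoly]
  exact (Polynomial.eval_map_algebraMap _ _).trans
    (Polynomial.aeval_algebraMap_apply_eq_algebraMap_eval _ _)

theorem eval_QmC_ofReal (m : ℕ) (t : ℝ) : (QmC m).eval (t : ℂ) = ((Qpoly m).eval t : ℝ) := by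
  rw [← map_Qpoly]
  exact (Polynomial.eval_map_algebraMap _ _).trans
    (Polynomial.aeval_algebraMap_apply_eq_algebraMap_eval _ _)

theorem conj_eval_PmC (m : ℕ) (z : ℂ) :
    (starRingEnd ℂ) ((PmC m).eval z) = (PmC m).eval ((starRingEnd ℂ) z) := by
  simp [PmC, Polynomial.eval_finsetSum]

theorem conj_eval_QmC (m : ℕ) (z : ℂ) :
    (starRingEnd ℂ) ((QmC m).eval z) = (QmC m).eval ((starRingEnd ℂ) z) := by
  simp [QmC, Polynomial.eval_finsetSum]

/-- No nontrivial real combination of `P_m` and `Q_m` vanishes off the real line. -/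
theorem eval_QmC_mul_sub_ne_zero {m : ℕ} (hm : Odd m) {z : ℂ} (hz : z.im ≠ 0) {u v : ℝ}
    (huv : u ≠ 0 ∨ v ≠ 0) : (QmC m).eval z * u - (PmC m).eval z * v ≠ 0 := by
  intro h
  have h1 := add_pow_eq_PmC_add_QmC hm z Complex.I Complex.I_sq
  have h2 := add_pow_eq_PmC_add_QmC hm z (-Complex.I) (by simp)
  have key : (z + Complex.I) ^ m * (u - v * Complex.I) =
      (z + -Complex.I) ^ m * (u + v * Complex.I) := by
    rw [h1, h2]
    linear_combination 2 * Complex.I * h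
  have hn : ‖((u : ℂ) - v * Complex.I)‖ = ‖((u : ℂ) + v * Complex.I)‖ := by
    rw [← Complex.norm_conj]
    simp
  have hne : ‖((u : ℂ) + v * Complex.I)‖ ≠ 0 := by
    rw [norm_ne_zero_iff]
    intro h0
    have hr := congrArg Complex.re h0
    have hi := congrArg Complex.im h0
    simp at hr hi
    simp [hr, hi] at huv
  have h3 := congrArg norm key
  rw [norm_mul, norm_mul, norm_pow, norm_pow, hn] at h3
  have h4 := mul_right_cancel₀ hne h3
  have h5 : ‖z + Complex.I‖ = ‖z + -Complex.I‖ :=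
    (pow_left_inj₀ (norm_nonneg _) (norm_nonneg _) hm.pos.ne').1 h4
  have h6 : Complex.normSq (z + Complex.I) = Complex.normSq (z + -Complex.I) := by
    rw [Complex.normSq_eq_norm_sq, Complex.normSq_eq_norm_sq, h5]
  simp [Complex.normSq_apply] at h6
  exact hz (by linarith)

theorem eval_QmC_ne_zero {m : ℕ} (hm : Odd m) {z : ℂ} (hz : z.im ≠ 0) :
    (QmC m).eval z ≠ 0 := by
  simpa using eval_QmC_mul_sub_ne_zero hm hz (u := 1) (v := 0) (by simp)

theorem eval_Ppoly_ne_zero_or {m : ℕ} (hm : Odd m) (t : ℝ) :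
    (Ppoly m).eval t ≠ 0 ∨ (Qpoly m).eval t ≠ 0 := by
  by_contra! h
  have h1 := add_pow_eq_PmC_add_QmC hm (t : ℂ) Complex.I Complex.I_sq
  rw [eval_PmC_ofReal, eval_QmC_ofReal, h.1, h.2] at h1
  have h2 : (t : ℂ) + Complex.I = 0 := by
    refine pow_eq_zero_iff hm.pos.ne' |>.1 ?_
    rw [h1]; simp
  simpa using congrArg Complex.im h2

theorem eval_cot_mul_sin_pow {m : ℕ} (hm : Odd m) {θ : ℝ} (h : Real.sin θ ≠ 0) :
    (Ppoly m).eval (Real.cos θ / Real.sin θ) * Real.sin θ ^ m = Real.cos (m * θ) ∧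
    (Qpoly m).eval (Real.cos θ / Real.sin θ) * Real.sin θ ^ m = Real.sin (m * θ) := by
  have h1 := add_pow_eq_PmC_add_QmC hm ((Real.cos θ / Real.sin θ : ℝ) : ℂ) Complex.I Complex.I_sq
  rw [eval_PmC_ofReal, eval_QmC_ofReal] at h1
  have hs : (Real.sin θ : ℂ) ≠ 0 := by exact_mod_cast h
  have h2 : (((Real.cos θ / Real.sin θ : ℝ) : ℂ) + Complex.I) * (Real.sin θ : ℂ) =
      Complex.cos θ + Complex.sin θ * Complex.I := by
    rw [← Complex.ofReal_cos, ← Complex.ofReal_sin]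
    push_cast at hs ⊢
    field_simp
  have h3 := congrArg (· ^ m) h2
  simp only [mul_pow] at h3
  rw [h1, Complex.cos_add_sin_mul_I_pow, show (m : ℂ) * θ = ((m * θ : ℝ) : ℂ) by push_cast; rfl,
    ← Complex.ofReal_cos, ← Complex.ofReal_sin, ← Complex.ofReal_pow] at h3
  constructor
  · simpa [-Complex.ofReal_pow, -Complex.ofReal_cos, -Complex.ofReal_sin] using
      congrArg Complex.re h3
  · simpa [-Complex.ofReal_pow, -Complex.ofReal_cos, -Complex.ofReal_sin] using
      congrArg Complex.im h3

theorem sum_eC_mul {R : Type*} [CommRing R] (f : ℂ →+* R) (m p : ℕ) (a₀ : ℝ) (x : Fin p → ℂ)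
    (hQ : ∀ j, (QmC m).eval (x j) ≠ 0) (u v : R) :
    ∑ l ∈ Finset.range (p + 1), f (eC m p a₀ x l) * u ^ (p - l) * v ^ l =
      f ((a₀ : ℂ) ^ m) * ∏ j, (f ((QmC m).eval (x j)) * u - f ((PmC m).eval (x j)) * v) := by
  have h1 : ∀ j, f ((QmC m).eval (x j)) * u - f ((PmC m).eval (x j)) * v =
      f ((QmC m).eval (x j)) *
        (f (-((PmC m).eval (x j) / (QmC m).eval (x j))) * v + u) := by
    intro j
    have : f ((PmC m).eval (x j)) =
      f ((QmC m).eval (x j)) * f ((PmC m).eval (x j) / (QmC m).eval (x j)) := by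
      rw [← map_mul, mul_div_cancel₀ _ (hQ j)]
    rw [this, map_neg]; ring
  rw [Finset.prod_congr rfl fun j _ => h1 j, Finset.prod_mul_distrib, Finset.prod_add,
    Finset.sum_powerset, Finset.card_univ, Fintype.card_fin, Finset.mul_sum, Finset.mul_sum]
  refine Finset.sum_congr rfl fun l _ => ?_
  have h2 : ∀ S ∈ Finset.powersetCard l (Finset.univ : Finset (Fin p)),
      (∏ i ∈ S, f (-((PmC m).eval (x i) / (QmC m).eval (x i))) * v) * ∏ i ∈ Finset.univ \ S, u =
      f ((-1) ^ l * ∏ i ∈ S, ((PmC m).eval (x i) / (QmC m).eval (x i))) * (u ^ (p - l) * v ^ l) := by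
    intro S hS
    have hc := (Finset.mem_powersetCard.1 hS).2
    rw [Finset.prod_mul_distrib, Finset.prod_const, Finset.prod_const, hc,
      Finset.card_sdiff_of_subset (Finset.subset_univ _), hc, Finset.card_univ, Fintype.card_fin,
      ← map_prod, Finset.prod_neg, hc]
    ring
  rw [Finset.sum_congr rfl h2, ← Finset.sum_mul, ← map_sum, ← Finset.mul_sum, ← map_prod, eC,
    esymmFn]
  simp only [map_mul]
  ring

theorem eC_im_eq_zero (m p : ℕ) (a₀ : ℝ) (x : Fin p → ℂ)
    (hx : Finset.univ.val.map (fun j => (starRingEnd ℂ) (x j)) = Finset.univ.val.map x) (l : ℕ) :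
    (eC m p a₀ x l).im = 0 := by
  rw [← Complex.conj_eq_iff_im]
  have h1 : ∀ y : Fin p → ℂ, eC m p a₀ y l = (a₀ : ℂ) ^ m * (-1) ^ l *
      (((Finset.univ.val.map y).map fun z => (QmC m).eval z).prod) *
      ((Finset.univ.val.map y).map fun z => (PmC m).eval z / (QmC m).eval z).esymm l := by
    intro y
    rw [Multiset.map_map, Multiset.map_map]
    rw [show (Multiset.map ((fun z => (PmC m).eval z / (QmC m).eval z) ∘ y) Finset.univ.val).esymm l
      = esymmFn p (fun j => (PmC m).eval (y j) / (QmC m).eval (y j)) l from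
        Finset.esymm_map_val _ _ _]
    rfl
  have h2 : (starRingEnd ℂ) (eC m p a₀ x l) = eC m p a₀ (fun j => (starRingEnd ℂ) (x j)) l := by
    simp [eC, esymmFn, conj_eval_PmC, conj_eval_QmC]
  rw [h2, h1, hx, ← h1]

theorem map_conj_roots {p : ℕ} (A : Polynomial ℝ) (a₀ : ℝ) (ha₀ : a₀ ≠ 0) (x : Fin p → ℂ)
    (h : A.map (algebraMap ℝ ℂ) =
      Polynomial.C (a₀ : ℂ) * ∏ j, (Polynomial.X - Polynomial.C (x j))) :
    Finset.univ.val.map (fun j => (starRingEnd ℂ) (x j)) = Finset.univ.val.map x := by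
  have h1 : (A.map (algebraMap ℝ ℂ)).map (starRingEnd ℂ) = A.map (algebraMap ℝ ℂ) := by
    rw [Polynomial.map_map]
    congr 1
    ext t
    simp
  have hr : ∀ y : Fin p → ℂ, (Polynomial.C (a₀ : ℂ) *
      ∏ j, (Polynomial.X - Polynomial.C (y j))).roots = Finset.univ.val.map y := by
    intro y
    rw [Polynomial.roots_C_mul _ (by exact_mod_cast ha₀)]
    have := Polynomial.roots_multiset_prod_X_sub_C (Finset.univ.val.map y)
    rw [Multiset.map_map] at this
    exact this
  rw [h] at h1
  rw [← hr, ← hr x, ← h1]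
  congr 1
  simp [Polynomial.map_prod, Polynomial.map_mul]

theorem integral_univ_eq_integral_cot (f : ℝ → ℝ) :
    ∫ t : ℝ, f t = ∫ θ in (0 : ℝ)..Real.pi, f (Real.cos θ / Real.sin θ) / Real.sin θ ^ 2 := by
  have h1 : ∫ t : ℝ, f t = ∫ t : ℝ, f (-t) := (MeasureTheory.integral_neg_eq_self f _).symm
  have h2 : ∀ y ∈ Set.Ioo (-(Real.pi / 2)) (Real.pi / 2), HasDerivWithinAt Real.tan
      (1 / Real.cos y ^ 2) (Set.Ioo (-(Real.pi / 2)) (Real.pi / 2)) y := fun y hy =>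
    (Real.hasDerivAt_tan (Real.cos_pos_of_mem_Ioo hy).ne').hasDerivWithinAt
  have h3 := MeasureTheory.integral_image_eq_integral_abs_deriv_smul measurableSet_Ioo h2
    Real.injOn_tan (fun t => f (-t))
  rw [Real.image_tan_Ioo, MeasureTheory.setIntegral_univ] at h3
  have hpi := Real.pi_pos
  have h4 := intervalIntegral.integral_comp_add_right (a := -(Real.pi / 2)) (b := Real.pi / 2)
    (fun θ => f (Real.cos θ / Real.sin θ) / Real.sin θ ^ 2) (Real.pi / 2)
  rw [show -(Real.pi / 2) + Real.pi / 2 = 0 by ring,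
    show Real.pi / 2 + Real.pi / 2 = Real.pi by ring] at h4
  rw [h1, h3, ← h4, intervalIntegral.integral_of_le (by linarith),
    MeasureTheory.integral_Ioc_eq_integral_Ioo]
  refine MeasureTheory.setIntegral_congr_fun measurableSet_Ioo fun y _ => ?_
  simp only [Real.cos_add_pi_div_two, Real.sin_add_pi_div_two, smul_eq_mul]
  rw [abs_of_nonneg (by positivity), Real.tan_eq_sin_div_cos, neg_div]
  ring

theorem Function.Periodic.intervalIntegral_comp_nat_mul {g : ℝ → ℝ} {c : ℝ} (hg : Continuous g)
    (hper : Function.Periodic g c) {m : ℕ} (hm : m ≠ 0) :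
    ∫ θ in (0 : ℝ)..c, g (m * θ) = ∫ θ in (0 : ℝ)..c, g θ := by
  have h := hper.intervalIntegral_add_zsmul_eq m 0 (fun _ _ => hg.intervalIntegrable _ _)
  have hm' : (m : ℝ) ≠ 0 := by exact_mod_cast hm
  rw [intervalIntegral.integral_comp_mul_left (fun θ => g θ) hm']
  simp only [zero_add, natCast_zsmul, nsmul_eq_mul] at h
  rw [mul_zero, h, smul_eq_mul, inv_mul_cancel_left₀ hm']

/-- Only the harmonics divisible by `m` survive integration against a function of `m * θ`. -/
theorem integral_cos_sin_mul_comp_nat_mul {g : ℝ → ℝ} (hg : Continuous g)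
    (hper : Function.Periodic g Real.pi) {m : ℕ} (hm : m ≠ 0) (n : ℤ) :
    (∫ θ in (0 : ℝ)..Real.pi, Real.cos (2 * n * θ) * g (m * θ) =
      if (m : ℤ) ∣ n then ∫ θ in (0 : ℝ)..Real.pi, Real.cos (2 * (n / m : ℤ) * θ) * g θ else 0) ∧
    (∫ θ in (0 : ℝ)..Real.pi, Real.sin (2 * n * θ) * g (m * θ) =
      if (m : ℤ) ∣ n then ∫ θ in (0 : ℝ)..Real.pi, Real.sin (2 * (n / m : ℤ) * θ) * g θ else 0) := by
  have hm' : (m : ℝ) ≠ 0 := by exact_mod_cast hm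
  have hmz : (m : ℤ) ≠ 0 := by exact_mod_cast hm
  have cosper : ∀ k : ℤ, ∀ θ : ℝ, Real.cos (2 * k * (θ + Real.pi)) = Real.cos (2 * k * θ) := by
    intro k θ
    rw [show 2 * k * (θ + Real.pi) = 2 * k * θ + k * (2 * Real.pi) by ring,
      Real.cos_add_int_mul_two_pi]
  have sinper : ∀ k : ℤ, ∀ θ : ℝ, Real.sin (2 * k * (θ + Real.pi)) = Real.sin (2 * k * θ) := by
    intro k θ
    rw [show 2 * k * (θ + Real.pi) = 2 * k * θ + k * (2 * Real.pi) by ring,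
      Real.sin_add_int_mul_two_pi]
  split_ifs with hd
  · obtain ⟨k, rfl⟩ := hd
    rw [Int.mul_ediv_cancel_left _ hmz]
    constructor
    · rw [← Function.Periodic.intervalIntegral_comp_nat_mul
        (g := fun θ => Real.cos (2 * k * θ) * g θ) (by fun_prop)
        (fun θ => by simp only [cosper, hper θ]) hm]
      refine intervalIntegral.integral_congr fun θ _ => ?_
      congr 2
      push_cast; ring
    · rw [← Function.Periodic.intervalIntegral_comp_nat_mul
        (g := fun θ => Real.sin (2 * k * θ) * g θ) (by fun_prop)
        (fun θ => by simp only [sinper, hper θ]) hm]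
      refine intervalIntegral.integral_congr fun θ _ => ?_
      congr 2
      push_cast; ring
  · set δ : ℝ := 2 * n * (Real.pi / m) with hδ
    have hgm : ∀ θ, g (m * (θ + Real.pi / m)) = g (m * θ) := fun θ => by
      rw [mul_add, mul_div_cancel₀ _ hm', hper]
    have hgp : ∀ θ, g (m * (θ + Real.pi)) = g (m * θ) := fun θ => by
      rw [mul_add]; exact hper.nat_mul m _
    have shift : ∀ F : ℝ → ℝ, Function.Periodic F Real.pi →
        ∫ θ in (0 : ℝ)..Real.pi, F (θ + Real.pi / m) = ∫ θ in (0 : ℝ)..Real.pi, F θ := by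
      intro F hF
      rw [intervalIntegral.integral_comp_add_right, zero_add, add_comm Real.pi,
        hF.intervalIntegral_add_eq _ 0, zero_add]
    set c := ∫ θ in (0 : ℝ)..Real.pi, Real.cos (2 * n * θ) * g (m * θ) with hc
    set s := ∫ θ in (0 : ℝ)..Real.pi, Real.sin (2 * n * θ) * g (m * θ) with hs
    have ic : ∀ r : ℝ, IntervalIntegrable (fun θ => r * (Real.cos (2 * n * θ) * g (m * θ)))
        MeasureTheory.volume 0 Real.pi := fun r => by
      apply Continuous.intervalIntegrable; fun_prop
    have is : ∀ r : ℝ, IntervalIntegrable (fun θ => r * (Real.sin (2 * n * θ) * g (m * θ)))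
        MeasureTheory.volume 0 Real.pi := fun r => by
      apply Continuous.intervalIntegrable; fun_prop
    have e1 : Real.cos δ * c - Real.sin δ * s = c := by
      rw [hc, hs, ← intervalIntegral.integral_const_mul,
        ← intervalIntegral.integral_const_mul, ← intervalIntegral.integral_sub (ic _) (is _),
        ← shift (fun θ => Real.cos (2 * n * θ) * g (m * θ))
        (fun θ => by simp only [cosper, hgp])]
      refine intervalIntegral.integral_congr fun θ _ => ?_
      simp only [hgm]
      rw [mul_add, ← hδ, Real.cos_add]; ring
    have e2 : Real.cos δ * s + Real.sin δ * c = s := by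
      rw [hc, hs, ← intervalIntegral.integral_const_mul,
        ← intervalIntegral.integral_const_mul, ← intervalIntegral.integral_add (is _) (ic _),
        ← shift (fun θ => Real.sin (2 * n * θ) * g (m * θ))
        (fun θ => by simp only [sinper, hgp])]
      refine intervalIntegral.integral_congr fun θ _ => ?_
      simp only [hgm]
      rw [mul_add, ← hδ, Real.sin_add]; ring
    have hne : 1 - Real.cos δ ≠ 0 := by
      intro h0
      obtain ⟨k, hk⟩ := (Real.cos_eq_one_iff δ).1 (by linarith)
      apply hd
      refine ⟨k, ?_⟩
      have : (k : ℝ) * m = n := by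
        have hpi := Real.pi_pos.ne'
        rw [hδ] at hk
        field_simp at hk
        linarith
      have h' : k * (m : ℤ) = n := by exact_mod_cast this
      rw [← h', mul_comm]
    have hsq := Real.sin_sq_add_cos_sq δ
    constructor
    · have : 2 * (1 - Real.cos δ) * c = 0 := by
        linear_combination (-1 + Real.cos δ) * e1 + (Real.sin δ) * e2 - c * hsq
      simpa [hne] using this
    · have : 2 * (1 - Real.cos δ) * s = 0 := by
        linear_combination (-1 + Real.cos δ) * e2 - (Real.sin δ) * e1 - s * hsq
      simpa [hne] using this

theorem sum_ite_dvd {m ν L : ℕ} (hL : L + 1 = m * ν) (f : ℕ → ℝ) :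
    ∑ i ∈ Finset.Icc 1 L, (if m ∣ i then f (i / m) else 0) =
      ∑ α ∈ Finset.Icc 1 (ν - 1), f α := by
  have hm : 0 < m := Nat.pos_of_ne_zero (by rintro rfl; simp at hL)
  rw [← Finset.sum_filter]
  refine Finset.sum_nbij' (fun i => i / m) (fun α => m * α) ?_ ?_ ?_ ?_ ?_
  · intro i hi
    simp only [Finset.mem_filter, Finset.mem_Icc] at hi ⊢
    obtain ⟨⟨h1, h2⟩, k, rfl⟩ := hi
    rw [Nat.mul_div_cancel_left _ hm]
    have : k < ν := Nat.lt_of_mul_lt_mul_left (a := m) (by omega)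
    have : k ≠ 0 := by rintro rfl; simp at h1
    omega
  · intro α hα
    simp only [Finset.mem_filter, Finset.mem_Icc] at hα ⊢
    have h1 : m * (α + 1) ≤ m * ν := Nat.mul_le_mul_left _ (by omega)
    have h2 : 0 < m * α := Nat.mul_pos hm (by omega)
    rw [mul_add] at h1
    exact ⟨⟨by omega, by omega⟩, dvd_mul_right _ _⟩
  · intro i hi
    simp only [Finset.mem_filter] at hi
    exact Nat.mul_div_cancel' hi.2
  · intro α _
    exact Nat.mul_div_cancel_left _ hm
  · intro i _
    rfl

theorem sum_range_two_mul_add_one_eq (f : ℕ → ℝ) (L : ℕ) :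
    ∑ n ∈ Finset.range (2 * L + 1), f n =
      f L + ∑ i ∈ Finset.Icc 1 L, (f (L + i) + f (L - i)) := by
  rw [show 2 * L + 1 = L + 1 + L by ring, Finset.sum_range_add, Finset.sum_range_succ,
    ← Finset.sum_range_reflect, Finset.sum_add_distrib, ← Finset.Ico_succ_right_eq_Icc,
    Finset.sum_Ico_eq_sum_range, Finset.sum_Ico_eq_sum_range]
  simp only [Order.succ_eq_add_one, Nat.add_sub_cancel]
  have h1 : ∀ k, L - 1 - k = L - (1 + k) := fun k => by omega
  have h2 : ∀ k, L + 1 + k = L + (1 + k) := fun k => by omega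
  simp only [h1, h2]
  ring

theorem sum_mul_ite_dvd {m ν L : ℕ} (hL : L + 1 = m * ν) (F : ℕ → ℝ) (D : ℤ → ℝ) :
    ∑ n ∈ Finset.range (2 * L + 1),
        F n * (if (m : ℤ) ∣ ((n : ℤ) - L) then D (((n : ℤ) - L) / m) else 0) =
      F L * D 0 +
        ∑ α ∈ Finset.Icc 1 (ν - 1), (F (L + α * m) * D α + F (L - α * m) * D (-α)) := by
  rw [sum_range_two_mul_add_one_eq, ← sum_ite_dvd hL]
  congr 1
  · simp
  · refine Finset.sum_congr rfl fun i hi => ?_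
    have hi := Finset.mem_Icc.1 hi
    have h1 : ((L + i : ℕ) : ℤ) - L = i := by push_cast; ring
    have h2 : ((L - i : ℕ) : ℤ) - L = -i := by rw [Nat.cast_sub hi.2]; ring
    rw [h1, h2]
    simp only [dvd_neg, Int.natCast_dvd_natCast]
    split_ifs with hd
    · rw [Nat.div_mul_cancel hd, Int.neg_ediv_of_dvd (by exact_mod_cast hd)]
      simp
    · simp

theorem T_eq_coeff (n a b : ℕ) :
    T n a b = ((Polynomial.X + Polynomial.C (-1 : ℝ)) ^ a * (Polynomial.X + 1) ^ b).coeff n := by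
  rw [Polynomial.coeff_mul, ← Finset.Nat.sum_antidiagonal_swap,
    Finset.Nat.sum_antidiagonal_eq_sum_range_succ_mk, T]
  refine Finset.sum_congr rfl fun j hj => ?_
  have hj := Finset.mem_range.1 hj
  simp only [Prod.fst_swap, Prod.snd_swap, Polynomial.coeff_X_add_C_pow,
    Polynomial.coeff_X_add_one_pow]
  by_cases h : n - j ≤ a
  · rw [show (a : ℤ) - n + j = ((a - (n - j) : ℕ) : ℤ) by omega, zpow_natCast]
  · rw [Nat.choose_eq_zero_of_lt (not_le.1 h)]
    simp

theorem sum_T_mul_pow (y : ℂ) (a b : ℕ) :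
    ∑ n ∈ Finset.range (a + b + 1), (T n a b : ℂ) * y ^ n = (y - 1) ^ a * (y + 1) ^ b := by
  set q : Polynomial ℝ := (Polynomial.X + Polynomial.C (-1 : ℝ)) ^ a * (Polynomial.X + 1) ^ b
    with hq
  have hdeg : (q.map (algebraMap ℝ ℂ)).natDegree < a + b + 1 := by
    refine Nat.lt_succ_of_le (Polynomial.natDegree_map_le.trans ?_)
    rw [hq]; compute_degree
  have h := Polynomial.eval_eq_sum_range' hdeg y
  simp only [Polynomial.coeff_map, hq, ← T_eq_coeff] at h
  rw [show ∑ n ∈ Finset.range (a + b + 1), (T n a b : ℂ) * y ^ n = _ from h.symm]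
  simp [sub_eq_add_neg]

theorem cos_pow_mul_sin_pow_eq {a b L : ℕ} (hab : a + b = 2 * L) (θ : ℝ) :
    (2 : ℂ) ^ (2 * L) * Complex.I ^ a * ((Real.cos θ ^ b * Real.sin θ ^ a : ℝ) : ℂ) =
      ∑ n ∈ Finset.range (2 * L + 1),
        (T n a b : ℂ) * Complex.exp ((2 * ((n : ℤ) - L : ℤ) * θ : ℝ) * Complex.I) := by
  have hexp : ∀ n : ℕ, Complex.exp ((2 * ((n : ℤ) - L : ℤ) * θ : ℝ) * Complex.I) =
      Complex.exp (-θ * Complex.I) ^ (2 * L) * (Complex.exp (θ * Complex.I) ^ 2) ^ n := by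
    intro n
    rw [← Complex.exp_nat_mul, ← Complex.exp_nat_mul, ← Complex.exp_nat_mul, ← Complex.exp_add]
    congr 1
    push_cast; ring
  simp only [hexp]
  rw [← hab]
  have h := sum_T_mul_pow (Complex.exp (θ * Complex.I) ^ 2) a b
  have h' : ∑ n ∈ Finset.range (a + b + 1), (T n a b : ℂ) *
      (Complex.exp (-θ * Complex.I) ^ (a + b) * (Complex.exp (θ * Complex.I) ^ 2) ^ n) =
      Complex.exp (-θ * Complex.I) ^ (a + b) *
      ∑ n ∈ Finset.range (a + b + 1), (T n a b : ℂ) * (Complex.exp (θ * Complex.I) ^ 2) ^ n := by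
    rw [Finset.mul_sum]
    exact Finset.sum_congr rfl fun n _ => by ring
  rw [h', h]
  have hee : Complex.exp (-θ * Complex.I) * Complex.exp (θ * Complex.I) = 1 := by
    rw [← Complex.exp_add]; simp
  have hc : 2 * (Real.cos θ : ℂ) =
      Complex.exp (-θ * Complex.I) * (Complex.exp (θ * Complex.I) ^ 2 + 1) := by
    rw [Complex.ofReal_cos, Complex.two_cos]
    linear_combination (-Complex.exp (θ * Complex.I)) * hee
  have hs : 2 * Complex.I * (Real.sin θ : ℂ) =
      Complex.exp (-θ * Complex.I) * (Complex.exp (θ * Complex.I) ^ 2 - 1) := by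
    have := Complex.two_sin (θ : ℂ)
    rw [Complex.ofReal_sin]
    linear_combination Complex.I * this - (Complex.exp (θ * Complex.I)) * hee +
      (Complex.exp (-θ * Complex.I) - Complex.exp (θ * Complex.I)) * Complex.I_sq
  calc _ = (2 * (Real.cos θ : ℂ)) ^ b * (2 * Complex.I * (Real.sin θ : ℂ)) ^ a := by
        push_cast; ring
    _ = _ := by rw [hc, hs, mul_pow, mul_pow]; ring

theorem cos_pow_mul_sin_pow_two_mul {j L : ℕ} (hj : j ≤ L) (θ : ℝ) :
    Real.cos θ ^ (2 * L - 2 * j) * Real.sin θ ^ (2 * j) =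
      1 / 2 ^ (2 * L) * (-1) ^ j * ∑ n ∈ Finset.range (2 * L + 1),
        T n (2 * j) (2 * L - 2 * j) * Real.cos (2 * ((n : ℤ) - L : ℤ) * θ) := by
  have h := cos_pow_mul_sin_pow_eq (a := 2 * j) (b := 2 * L - 2 * j) (L := L) (by omega) θ
  have h1 : (2 : ℂ) ^ (2 * L) * Complex.I ^ (2 * j) = ((2 ^ (2 * L) * (-1) ^ j : ℝ) : ℂ) := by
    rw [pow_mul Complex.I, Complex.I_sq]; push_cast; rfl
  have h2 := congrArg Complex.re h
  rw [h1, ← Complex.ofReal_mul, Complex.ofReal_re, Complex.re_sum] at h2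
  simp only [Complex.re_ofReal_mul, Complex.exp_ofReal_mul_I_re] at h2
  rw [← h2]
  have h3 : ((-1 : ℝ) ^ j) * (-1) ^ j = 1 := by rw [← mul_pow]; simp
  field_simp
  linear_combination (-Real.cos θ ^ (2 * L - 2 * j) * Real.sin θ ^ (2 * j)) * h3

theorem cos_pow_mul_sin_pow_two_mul_add_one {j L : ℕ} (hj : j < L) (θ : ℝ) :
    Real.cos θ ^ (2 * L - (2 * j + 1)) * Real.sin θ ^ (2 * j + 1) =
      1 / 2 ^ (2 * L) * (-1) ^ j * ∑ n ∈ Finset.range (2 * L + 1),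
        T n (2 * j + 1) (2 * L - (2 * j + 1)) * Real.sin (2 * ((n : ℤ) - L : ℤ) * θ) := by
  have h := cos_pow_mul_sin_pow_eq (a := 2 * j + 1) (b := 2 * L - (2 * j + 1)) (L := L)
    (by omega) θ
  have h1 : (2 : ℂ) ^ (2 * L) * Complex.I ^ (2 * j + 1) =
      ((2 ^ (2 * L) * (-1) ^ j : ℝ) : ℂ) * Complex.I := by
    rw [pow_succ, pow_mul Complex.I, Complex.I_sq]; push_cast; ring
  have h2 := congrArg Complex.im h
  rw [h1, mul_right_comm, ← Complex.ofReal_mul, Complex.im_ofReal_mul, Complex.I_im, mul_one,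
    Complex.im_sum] at h2
  simp only [Complex.im_ofReal_mul, Complex.exp_ofReal_mul_I_im] at h2
  rw [← h2]
  have h3 : ((-1 : ℝ) ^ j) * (-1) ^ j = 1 := by rw [← mul_pow]; simp
  field_simp
  linear_combination (-Real.cos θ ^ (2 * L - (2 * j + 1)) * Real.sin θ ^ (2 * j + 1)) * h3

theorem integral_cos_pow_mul_sin_pow_even {g : ℝ → ℝ} (hg : Continuous g)
    (hper : Function.Periodic g Real.pi) {m ν L j : ℕ} (hm : m ≠ 0) (hL : L + 1 = m * ν)
    (hj : j ≤ L) :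
    ∫ θ in (0 : ℝ)..Real.pi,
        Real.cos θ ^ (2 * L - 2 * j) * Real.sin θ ^ (2 * j) * g (m * θ) =
      ∫ θ in (0 : ℝ)..Real.pi, 1 / 2 ^ (2 * L) * (-1) ^ j * (T L (2 * j) (2 * L - 2 * j) +
        ∑ α ∈ Finset.Icc 1 (ν - 1),
          (T (L + α * m) (2 * j) (2 * L - 2 * j) + T (L - α * m) (2 * j) (2 * L - 2 * j)) *
            Real.cos (2 * α * θ)) * g θ := by
  have key := sum_mul_ite_dvd hL (fun n => T n (2 * j) (2 * L - 2 * j))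
    (fun k => ∫ θ in (0 : ℝ)..Real.pi, Real.cos (2 * k * θ) * g θ)
  simp only [← (integral_cos_sin_mul_comp_nat_mul hg hper hm _).1] at key
  simp only [cos_pow_mul_sin_pow_two_mul hj, mul_assoc, intervalIntegral.integral_const_mul]
  congr 2
  simp only [Finset.sum_mul, add_mul]
  rw [intervalIntegral.integral_finsetSum, intervalIntegral.integral_add,
    intervalIntegral.integral_finsetSum]
  · simp only [mul_assoc, intervalIntegral.integral_const_mul] at key ⊢
    rw [key]
    congr 1
    · simp
    · refine Finset.sum_congr rfl fun α _ => ?_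
      rw [intervalIntegral.integral_add, intervalIntegral.integral_const_mul,
        intervalIntegral.integral_const_mul]
      · congr 2
        simp
      · apply Continuous.intervalIntegrable; fun_prop
      · apply Continuous.intervalIntegrable; fun_prop
  all_goals intros; apply Continuous.intervalIntegrable; fun_prop

theorem integral_cos_pow_mul_sin_pow_odd {g : ℝ → ℝ} (hg : Continuous g)
    (hper : Function.Periodic g Real.pi) {m ν L j : ℕ} (hm : m ≠ 0) (hL : L + 1 = m * ν)
    (hj : j < L) :
    ∫ θ in (0 : ℝ)..Real.pi,
        Real.cos θ ^ (2 * L - (2 * j + 1)) * Real.sin θ ^ (2 * j + 1) * g (m * θ) =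
      ∫ θ in (0 : ℝ)..Real.pi, 1 / 2 ^ (2 * L) * (-1) ^ j *
        (∑ α ∈ Finset.Icc 1 (ν - 1),
          (T (L + α * m) (2 * j + 1) (2 * L - (2 * j + 1)) -
            T (L - α * m) (2 * j + 1) (2 * L - (2 * j + 1))) *
            Real.sin (2 * α * θ)) * g θ := by
  have key := sum_mul_ite_dvd hL (fun n => T n (2 * j + 1) (2 * L - (2 * j + 1)))
    (fun k => ∫ θ in (0 : ℝ)..Real.pi, Real.sin (2 * k * θ) * g θ)
  simp only [← (integral_cos_sin_mul_comp_nat_mul hg hper hm _).2] at key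
  simp only [cos_pow_mul_sin_pow_two_mul_add_one hj, mul_assoc,
    intervalIntegral.integral_const_mul]
  congr 2
  simp only [Finset.sum_mul, sub_mul]
  rw [intervalIntegral.integral_finsetSum, intervalIntegral.integral_finsetSum]
  · simp only [mul_assoc, intervalIntegral.integral_const_mul] at key ⊢
    rw [key]
    simp only [Int.cast_zero, zero_mul, mul_zero, Real.sin_zero, intervalIntegral.integral_zero,
      zero_add]
    refine Finset.sum_congr rfl fun α _ => ?_
    rw [intervalIntegral.integral_sub, intervalIntegral.integral_const_mul,
      intervalIntegral.integral_const_mul, sub_eq_add_neg, ← mul_neg,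
      ← intervalIntegral.integral_neg]
    · congr 2
      simp
    · apply Continuous.intervalIntegrable; fun_prop
    · apply Continuous.intervalIntegrable; fun_prop
  all_goals intros; apply Continuous.intervalIntegrable; fun_prop

theorem sum_choose_even_succ {N α : ℕ} (h : α + 1 < N) (y : ℝ) :
    ∑ k ∈ Finset.range N, y ^ k * ((α + 1 + k).choose (2 * k) : ℝ) =
      ∑ k ∈ Finset.range N, y ^ k * ((α + k).choose (2 * k) : ℝ) +
        y * ∑ k ∈ Finset.range N, y ^ k * ((α + 1 + k).choose (2 * k + 1) : ℝ) := by
  obtain ⟨M, rfl⟩ : ∃ M, N = M + 1 := ⟨N - 1, by omega⟩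
  rw [Finset.sum_range_succ', Finset.sum_range_succ' _ M,
    Finset.sum_range_succ (fun k => y ^ k * ((α + 1 + k).choose (2 * k + 1) : ℝ)),
    Nat.choose_eq_zero_of_lt (show α + 1 + M < 2 * M + 1 by omega)]
  have h1 : ∀ k ∈ Finset.range M,
      y ^ (k + 1) * ((α + 1 + (k + 1)).choose (2 * (k + 1)) : ℝ) =
      y ^ (k + 1) * ((α + (k + 1)).choose (2 * (k + 1)) : ℝ) +
        y * (y ^ k * ((α + 1 + k).choose (2 * k + 1) : ℝ)) := by
    intro k _
    rw [show α + 1 + (k + 1) = α + 1 + k + 1 by ring, show 2 * (k + 1) = 2 * k + 1 + 1 by ring,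
      Nat.choose_succ_succ, show α + (k + 1) = α + 1 + k by ring]
    push_cast; ring
  rw [Finset.sum_congr rfl h1, Finset.sum_add_distrib, ← Finset.mul_sum]
  simp
  ring

theorem sin_cos_two_mul_nat_mul (N α : ℕ) (h : α < N) (θ : ℝ) :
    Real.sin (2 * α * θ) = 2 * Real.sin θ * Real.cos θ *
      (∑ k ∈ Finset.range N, (-4 * Real.sin θ ^ 2) ^ k * ((α + k).choose (2 * k + 1))) ∧
    Real.cos (2 * α * θ) =
      ∑ k ∈ Finset.range N, (-4 * Real.sin θ ^ 2) ^ k * ((α + k).choose (2 * k)) +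
      2 * Real.sin θ ^ 2 *
        ∑ k ∈ Finset.range N, (-4 * Real.sin θ ^ 2) ^ k * ((α + k).choose (2 * k + 1)) := by
  have hsq := Real.sin_sq_add_cos_sq θ
  induction α with
  | zero =>
    have h1 : ∀ k : ℕ, ((0 + k).choose (2 * k + 1) : ℝ) = 0 := fun k => by
      rw [Nat.choose_eq_zero_of_lt (by omega), Nat.cast_zero]
    have h2 : ∀ k : ℕ, k ≠ 0 → ((0 + k).choose (2 * k) : ℝ) = 0 := fun k hk => by
      rw [Nat.choose_eq_zero_of_lt (by omega), Nat.cast_zero]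
    simp only [h1, mul_zero, Finset.sum_const_zero, add_zero]
    rw [Finset.sum_eq_single_of_mem 0 (by simpa using h)
      (fun k _ hk => by rw [h2 k hk, mul_zero])]
    simp
  | succ α ih =>
    obtain ⟨ih1, ih2⟩ := ih (by omega)
    have hW : ∑ k ∈ Finset.range N, (-4 * Real.sin θ ^ 2) ^ k * ((α + 1 + k).choose (2 * k + 1) : ℝ)
        = ∑ k ∈ Finset.range N, (-4 * Real.sin θ ^ 2) ^ k * ((α + k).choose (2 * k) : ℝ) +
          ∑ k ∈ Finset.range N, (-4 * Real.sin θ ^ 2) ^ k * ((α + k).choose (2 * k + 1) : ℝ) := by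
      rw [← Finset.sum_add_distrib]
      refine Finset.sum_congr rfl fun k _ => ?_
      rw [show α + 1 + k = α + k + 1 by ring, Nat.choose_succ_succ]
      push_cast; ring
    have hV := sum_choose_even_succ (N := N) (α := α) (by omega) (-4 * Real.sin θ ^ 2)
    have hang : 2 * ((α + 1 : ℕ) : ℝ) * θ = 2 * α * θ + 2 * θ := by push_cast; ring
    rw [hang, Real.sin_add, Real.cos_add, hV, hW, ih1, ih2, Real.cos_two_mul, Real.sin_two_mul]
    set W := ∑ k ∈ Finset.range N, (-4 * Real.sin θ ^ 2) ^ k * ((α + k).choose (2 * k + 1) : ℝ)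
    set V := ∑ k ∈ Finset.range N, (-4 * Real.sin θ ^ 2) ^ k * ((α + k).choose (2 * k) : ℝ)
    have hc : Real.cos θ ^ 2 = 1 - Real.sin θ ^ 2 := by linarith
    constructor
    · rw [hc]; ring
    · linear_combination (2 * V) * hsq

theorem sin_two_mul_nat_mul (α : ℕ) (θ : ℝ) :
    Real.sin (2 * α * θ) = ∑ β ∈ Finset.range α, (-1) ^ β * 2 ^ (2 * β + 1) *
      ((α + β).choose (2 * β + 1)) * (Real.sin θ ^ (2 * β + 1) * Real.cos θ) := by
  rw [(sin_cos_two_mul_nat_mul (α + 1) α (by omega) θ).1, Finset.sum_range_succ,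
    Nat.choose_eq_zero_of_lt (show α + α < 2 * α + 1 by omega), Nat.cast_zero, mul_zero, add_zero,
    Finset.mul_sum]
  refine Finset.sum_congr rfl fun β _ => ?_
  rw [show (-4 * Real.sin θ ^ 2) = (-1) * (2 ^ 2 * Real.sin θ ^ 2) by ring, mul_pow, mul_pow,
    ← pow_mul 2 2]
  ring

theorem cos_two_mul_nat_mul {α : ℕ} (hα : 1 ≤ α) (θ : ℝ) :
    Real.cos (2 * α * θ) = ∑ β ∈ Finset.range (α + 1), (-1) ^ (α - β) *
      (2 ^ (2 * (α - β)) * (α : ℝ) / ((2 * α - β : ℕ) : ℝ)) * ((2 * α - β).choose β) *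
        Real.sin θ ^ (2 * (α - β)) := by
  obtain ⟨α, rfl⟩ : ∃ a, α = a + 1 := ⟨α - 1, by omega⟩
  rw [← Finset.sum_range_reflect, (sin_cos_two_mul_nat_mul (α + 1 + 1) (α + 1) (by omega) θ).2]
  have hs : ∀ k ∈ Finset.range (α + 1 + 1), ((α + 1 + k).choose (2 * k) : ℝ) * (α + 1 : ℕ) /
      ((α + 1 + k : ℕ) : ℝ) = ((α + 1 + k).choose (2 * k) + (α + k).choose (2 * k) : ℝ) / 2 := by
    intro k _
    have h2 := Nat.choose_mul_succ_eq (α + k) (2 * k)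
    by_cases hk : 2 * k ≤ α + k + 1
    · have h3 : ((α + k).choose (2 * k) : ℝ) * (α + k + 1) =
          ((α + k + 1).choose (2 * k)) * (α + 1 - k) := by
        have : ((α + k + 1 - 2 * k : ℕ) : ℝ) = α + 1 - k := by
          rw [Nat.cast_sub hk]; push_cast; ring
        rw [← this]; exact_mod_cast h2
      rw [show α + 1 + k = α + k + 1 by ring]
      have hne : (α + k + 1 : ℝ) ≠ 0 := by positivity
      push_cast
      field_simp
      linear_combination -h3
    · rw [Nat.choose_eq_zero_of_lt (by omega : α + 1 + k < 2 * k),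
        Nat.choose_eq_zero_of_lt (by omega : α + k < 2 * k)]
      simp
  have hterm : ∀ k ∈ Finset.range (α + 1 + 1),
      (-1 : ℝ) ^ (α + 1 - (α + 1 + 1 - 1 - k)) *
      (2 ^ (2 * (α + 1 - (α + 1 + 1 - 1 - k))) * ((α + 1 : ℕ) : ℝ) /
        ((2 * (α + 1) - (α + 1 + 1 - 1 - k) : ℕ) : ℝ)) *
        ((2 * (α + 1) - (α + 1 + 1 - 1 - k)).choose (α + 1 + 1 - 1 - k)) *
        Real.sin θ ^ (2 * (α + 1 - (α + 1 + 1 - 1 - k))) =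
      (-4 * Real.sin θ ^ 2) ^ k *
        (((α + 1 + k).choose (2 * k) + (α + k).choose (2 * k) : ℝ) / 2) := by
    intro k hk
    rw [← hs k hk]
    have hk := Finset.mem_range.1 hk
    rw [show α + 1 - (α + 1 + 1 - 1 - k) = k by omega,
      show 2 * (α + 1) - (α + 1 + 1 - 1 - k) = α + 1 + k by omega,
      show α + 1 + 1 - 1 - k = α + 1 + k - 2 * k by omega, Nat.choose_symm (by omega),
      show (-4 * Real.sin θ ^ 2) = (-1) * (2 ^ 2 * Real.sin θ ^ 2) by ring, mul_pow, mul_pow,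
    ← pow_mul 2 2]
    ring
  rw [Finset.sum_congr rfl hterm]
  have hV := sum_choose_even_succ (N := α + 1 + 1) (α := α) (by omega) (-4 * Real.sin θ ^ 2)
  have h2 : ∑ k ∈ Finset.range (α + 1 + 1), (-4 * Real.sin θ ^ 2) ^ k *
        (((α + 1 + k).choose (2 * k) + (α + k).choose (2 * k) : ℝ) / 2) =
      (∑ k ∈ Finset.range (α + 1 + 1),
        (-4 * Real.sin θ ^ 2) ^ k * ((α + 1 + k).choose (2 * k) : ℝ) +
      ∑ k ∈ Finset.range (α + 1 + 1),
        (-4 * Real.sin θ ^ 2) ^ k * ((α + k).choose (2 * k) : ℝ)) / 2 := by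
    rw [← Finset.sum_add_distrib, Finset.sum_div]
    exact Finset.sum_congr rfl fun k _ => by ring
  rw [h2]
  linear_combination hV / 2

theorem M1_eq (m ν : ℕ) (c : ℕ → ℝ) (γ j α β : ℕ) :
    M1 m (2 * ν) c γ j α β = (-1) ^ j * c (2 * j) *
      (T ((m * (2 * ν) - 2) / 2 + α * m) (2 * j) (m * (2 * ν) - 2 - 2 * j) +
        T ((m * (2 * ν) - 2) / 2 - α * m) (2 * j) (m * (2 * ν) - 2 - 2 * j)) *
      ((-1) ^ (α - β) *
        (2 ^ (2 * (α - β)) * (α : ℝ) / ((2 * α - β : ℕ) : ℝ)) * ((2 * α - β).choose β)) *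
      ((ν - α - 1 + β).choose γ) := by
  rw [M1, Nat.mul_div_cancel_left ν two_pos]
  ring

theorem M2_eq (m ν : ℕ) (c : ℕ → ℝ) (γ j α β : ℕ) :
    M2 m (2 * ν) c γ j α β = (-1) ^ j * c (2 * j + 1) *
      (T ((m * (2 * ν) - 2) / 2 + α * m) (2 * j + 1) (m * (2 * ν) - 2 - (2 * j + 1)) -
        T ((m * (2 * ν) - 2) / 2 - α * m) (2 * j + 1) (m * (2 * ν) - 2 - (2 * j + 1))) *
      ((-1) ^ β * 2 ^ (2 * β + 1) * ((α + β).choose (2 * β + 1))) *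
      ((ν - 2 - β).choose γ) := by
  rw [M2, Nat.mul_div_cancel_left ν two_pos]
  ring

theorem sum_Icc_split {ν γ : ℕ} (h : γ < ν) (f : ℕ → ℝ) :
    ∑ α ∈ Finset.Icc 1 (ν - 1 - γ), f α + ∑ α ∈ Finset.Icc (ν - γ) (ν - 1), f α =
      ∑ α ∈ Finset.Icc 1 (ν - 1), f α := by
  rw [← Finset.sum_union]
  · refine Finset.sum_congr ?_ fun _ _ => rfl
    ext α
    simp only [Finset.mem_union, Finset.mem_Icc]
    omega
  · rw [Finset.disjoint_left]
    intro α
    simp only [Finset.mem_Icc]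
    omega

/-- Amalgamation of the four truncated sums in `Jfun`. -/
theorem Jfun_eq (m ν : ℕ) (hν : 0 < ν) (c : ℕ → ℝ) (t : ℝ) :
    Jfun m (2 * ν) c t = 1 / 2 ^ (m * (2 * ν) - 2) *
      ((∑ γ ∈ Finset.range ν, ((((ν - 1).choose γ : ℝ)) *
          ∑ j ∈ Finset.range ((m * (2 * ν) - 2) / 2 + 1), (-1 : ℝ) ^ j * c (2 * j) *
            T ((m * (2 * ν) - 2) / 2) (2 * j) (m * (2 * ν) - 2 - 2 * j)) * t ^ (2 * γ)) +
       (∑ γ ∈ Finset.range ν, (∑ j ∈ Finset.range ((m * (2 * ν) - 2) / 2 + 1),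
          ∑ α ∈ Finset.Icc 1 (ν - 1), ∑ β ∈ Finset.range (α + 1), M1 m (2 * ν) c γ j α β) *
            t ^ (2 * γ)) +
       (∑ γ ∈ Finset.range ν, (∑ j ∈ Finset.range ((m * (2 * ν) - 2) / 2),
          ∑ α ∈ Finset.Icc 1 (ν - 1), ∑ β ∈ Finset.range α, M2 m (2 * ν) c γ j α β) *
            t ^ (2 * γ + 1))) := by
  obtain ⟨n, rfl⟩ : ∃ n, ν = n + 1 := ⟨ν - 1, by omega⟩
  have comb : ∀ a b c d e : ℝ, a + b + c + d + e = a + (b + c) + (d + e) := fun _ _ _ _ _ => by ring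
  rw [Jfun, Nat.mul_div_cancel_left (n + 1) two_pos, comb]
  congr 2
  · congr 1
    have h1 : ∑ γ ∈ Finset.range (n + 1 - 1), (∑ j ∈ Finset.range ((m * (2 * (n + 1)) - 2) / 2 + 1),
        ∑ α ∈ Finset.Icc 1 (n + 1 - 1 - γ), ∑ β ∈ Finset.range (α + 1),
          M1 m (2 * (n + 1)) c γ j α β) * t ^ (2 * γ) =
        ∑ γ ∈ Finset.range (n + 1), (∑ j ∈ Finset.range ((m * (2 * (n + 1)) - 2) / 2 + 1),
        ∑ α ∈ Finset.Icc 1 (n + 1 - 1 - γ), ∑ β ∈ Finset.range (α + 1),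
          M1 m (2 * (n + 1)) c γ j α β) * t ^ (2 * γ) := by
      rw [Finset.sum_range_succ]
      simp
    have h2 : ∑ γ ∈ Finset.Icc 1 (n + 1 - 1),
        (∑ j ∈ Finset.range ((m * (2 * (n + 1)) - 2) / 2 + 1),
          ∑ α ∈ Finset.Icc (n + 1 - γ) (n + 1 - 1),
            ∑ β ∈ Finset.Icc (α + γ + 1 - (n + 1)) α, M1 m (2 * (n + 1)) c γ j α β) *
              t ^ (2 * γ) =
        ∑ γ ∈ Finset.range (n + 1),
        (∑ j ∈ Finset.range ((m * (2 * (n + 1)) - 2) / 2 + 1),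
          ∑ α ∈ Finset.Icc (n + 1 - γ) (n + 1 - 1),
            ∑ β ∈ Finset.range (α + 1), M1 m (2 * (n + 1)) c γ j α β) * t ^ (2 * γ) := by
      rw [← Finset.sum_subset (s₁ := Finset.Icc 1 (n + 1 - 1)) (s₂ := Finset.range (n + 1))]
      · refine Finset.sum_congr rfl fun γ hγ => ?_
        congr 1
        refine Finset.sum_congr rfl fun j _ => Finset.sum_congr rfl fun α hα => ?_
        rw [Finset.mem_Icc] at hγ hα
        refine Finset.sum_subset (fun β => ?_) fun β hβ hβ' => ?_
        · simp only [Finset.mem_Icc, Finset.mem_range]; omega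
        · simp only [Finset.mem_Icc, Finset.mem_range] at hβ hβ'
          rw [M1_eq, Nat.choose_eq_zero_of_lt (by omega : n + 1 - α - 1 + β < γ)]
          simp
      · intro γ
        simp only [Finset.mem_Icc, Finset.mem_range]; omega
      · intro γ hγ hγ'
        simp only [Finset.mem_Icc, Finset.mem_range] at hγ hγ'
        obtain rfl : γ = 0 := by omega
        simp
    rw [h1, h2, ← Finset.sum_add_distrib]
    refine Finset.sum_congr rfl fun γ hγ => ?_
    rw [← add_mul, ← Finset.sum_add_distrib]
    simp only [sum_Icc_split (Finset.mem_range.1 hγ)]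
  · have h1 : ∑ γ ∈ Finset.range (n + 1 - 1), (∑ j ∈ Finset.range ((m * (2 * (n + 1)) - 2) / 2),
        ∑ α ∈ Finset.Icc 1 (n + 1 - 1 - γ), ∑ β ∈ Finset.range α,
          M2 m (2 * (n + 1)) c γ j α β) * t ^ (2 * γ + 1) =
        ∑ γ ∈ Finset.range (n + 1), (∑ j ∈ Finset.range ((m * (2 * (n + 1)) - 2) / 2),
        ∑ α ∈ Finset.Icc 1 (n + 1 - 1 - γ), ∑ β ∈ Finset.range α,
          M2 m (2 * (n + 1)) c γ j α β) * t ^ (2 * γ + 1) := by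
      rw [Finset.sum_range_succ]
      simp
    have h2 : ∑ γ ∈ Finset.Icc 1 (n + 1 - 2),
        (∑ j ∈ Finset.range ((m * (2 * (n + 1)) - 2) / 2),
          ∑ α ∈ Finset.Icc (n + 1 - γ) (n + 1 - 1),
            ∑ β ∈ Finset.range α, M2 m (2 * (n + 1)) c γ j α β) * t ^ (2 * γ + 1) =
        ∑ γ ∈ Finset.range (n + 1),
        (∑ j ∈ Finset.range ((m * (2 * (n + 1)) - 2) / 2),
          ∑ α ∈ Finset.Icc (n + 1 - γ) (n + 1 - 1),
            ∑ β ∈ Finset.range α, M2 m (2 * (n + 1)) c γ j α β) * t ^ (2 * γ + 1) := by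
      refine Finset.sum_subset (fun γ => ?_) fun γ hγ hγ' => ?_
      · simp only [Finset.mem_Icc, Finset.mem_range]; omega
      · simp only [Finset.mem_Icc, Finset.mem_range] at hγ hγ'
        obtain rfl | hγn : γ = 0 ∨ γ = n := by omega
        · simp
        · rw [Finset.sum_eq_zero, zero_mul]
          refine fun j _ => Finset.sum_eq_zero fun α hα => Finset.sum_eq_zero fun β hβ => ?_
          rw [Finset.mem_Icc] at hα
          rw [Finset.mem_range] at hβ
          rw [M2_eq, Nat.choose_eq_zero_of_lt (by omega : n + 1 - 2 - β < γ)]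
          simp
    rw [h1, h2, ← Finset.sum_add_distrib]
    refine Finset.sum_congr rfl fun γ hγ => ?_
    rw [← add_mul, ← Finset.sum_add_distrib]
    simp only [sum_Icc_split (Finset.mem_range.1 hγ)]

theorem sum_choose_mul_pow {n N : ℕ} (h : n < N) (y : ℝ) :
    ∑ γ ∈ Finset.range N, (n.choose γ : ℝ) * y ^ γ = (1 + y) ^ n := by
  rw [add_comm, add_pow, ← Finset.sum_subset (Finset.range_mono (Nat.succ_le_of_lt h))]
  · exact Finset.sum_congr rfl fun γ _ => by simp [mul_comm]
  · intro γ _ hγ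
    rw [Nat.choose_eq_zero_of_lt (by simpa using hγ)]
    simp

theorem sin_pow_mul_sum_choose {n k N : ℕ} (h : n < N) {φ : ℝ} (hs : Real.sin φ ≠ 0) :
    Real.sin φ ^ (2 * (n + k)) *
      ∑ γ ∈ Finset.range N, (n.choose γ : ℝ) * (Real.cos φ / Real.sin φ) ^ (2 * γ) =
      Real.sin φ ^ (2 * k) := by
  simp only [pow_mul]
  rw [sum_choose_mul_pow h]
  have h1 : 1 + (Real.cos φ / Real.sin φ) ^ 2 = (Real.sin φ ^ 2)⁻¹ := by
    have := Real.sin_sq_add_cos_sq φ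
    field_simp
    exact this
  rw [h1, pow_add, inv_pow]
  field_simp

theorem sin_pow_mul_sum_M1 (m ν : ℕ) (c : ℕ → ℝ) {j α : ℕ} (h1 : 1 ≤ α) (h2 : α < ν) {φ : ℝ}
    (hs : Real.sin φ ≠ 0) :
    Real.sin φ ^ (2 * (ν - 1)) * ∑ β ∈ Finset.range (α + 1), ∑ γ ∈ Finset.range ν,
        M1 m (2 * ν) c γ j α β * (Real.cos φ / Real.sin φ) ^ (2 * γ) =
      (-1) ^ j * c (2 * j) *
      (T ((m * (2 * ν) - 2) / 2 + α * m) (2 * j) (m * (2 * ν) - 2 - 2 * j) +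
        T ((m * (2 * ν) - 2) / 2 - α * m) (2 * j) (m * (2 * ν) - 2 - 2 * j)) *
      Real.cos (2 * α * φ) := by
  rw [cos_two_mul_nat_mul h1, Finset.mul_sum, Finset.mul_sum]
  refine Finset.sum_congr rfl fun β hβ => ?_
  have hβ := Finset.mem_range.1 hβ
  simp only [M1_eq, mul_assoc]
  simp only [← Finset.mul_sum]
  rw [← sin_pow_mul_sum_choose (n := ν - α - 1 + β) (k := α - β) (N := ν) (by omega) hs,
    show ν - α - 1 + β + (α - β) = ν - 1 by omega]
  ring

theorem sin_pow_mul_sum_M2 (m ν : ℕ) (c : ℕ → ℝ) {j α : ℕ} (h2 : α < ν) {φ : ℝ}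
    (hs : Real.sin φ ≠ 0) :
    Real.sin φ ^ (2 * (ν - 1)) * ∑ β ∈ Finset.range α, ∑ γ ∈ Finset.range ν,
        M2 m (2 * ν) c γ j α β * (Real.cos φ / Real.sin φ) ^ (2 * γ + 1) =
      (-1) ^ j * c (2 * j + 1) *
      (T ((m * (2 * ν) - 2) / 2 + α * m) (2 * j + 1) (m * (2 * ν) - 2 - (2 * j + 1)) -
        T ((m * (2 * ν) - 2) / 2 - α * m) (2 * j + 1) (m * (2 * ν) - 2 - (2 * j + 1))) *
      Real.sin (2 * α * φ) := by
  rw [sin_two_mul_nat_mul, Finset.mul_sum, Finset.mul_sum]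
  refine Finset.sum_congr rfl fun β hβ => ?_
  have hβ := Finset.mem_range.1 hβ
  have h3 : Real.sin φ ^ (2 * β + 1) * Real.cos φ =
      Real.sin φ ^ (2 * (β + 1)) * (Real.cos φ / Real.sin φ) := by
    field_simp
    ring
  have h4 : ∀ (γ : ℕ) (K w t : ℝ), K * w * t ^ (2 * γ + 1) = K * t * (w * t ^ (2 * γ)) :=
    fun _ _ _ _ => by ring
  simp only [M2_eq, h4, ← Finset.mul_sum]
  rw [h3, ← sin_pow_mul_sum_choose (n := ν - 2 - β) (k := β + 1) (N := ν) (by omega) hs,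
    show ν - 2 - β + (β + 1) = ν - 1 by omega]
  ring

theorem sin_pow_mul_Jfun (m ν L : ℕ) (hν : 0 < ν) (hL : L + 1 = m * ν) (c : ℕ → ℝ) {φ : ℝ}
    (hs : Real.sin φ ≠ 0) :
    Real.sin φ ^ (2 * (ν - 1)) * Jfun m (2 * ν) c (Real.cos φ / Real.sin φ) =
      ∑ j ∈ Finset.range (L + 1), c (2 * j) * (1 / 2 ^ (2 * L) * (-1) ^ j *
        (T L (2 * j) (2 * L - 2 * j) + ∑ α ∈ Finset.Icc 1 (ν - 1),
          (T (L + α * m) (2 * j) (2 * L - 2 * j) + T (L - α * m) (2 * j) (2 * L - 2 * j)) *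
            Real.cos (2 * α * φ))) +
      ∑ j ∈ Finset.range L, c (2 * j + 1) * (1 / 2 ^ (2 * L) * (-1) ^ j *
        (∑ α ∈ Finset.Icc 1 (ν - 1),
          (T (L + α * m) (2 * j + 1) (2 * L - (2 * j + 1)) -
            T (L - α * m) (2 * j + 1) (2 * L - (2 * j + 1))) * Real.sin (2 * α * φ))) := by
  have hs1 : m * (2 * ν) - 2 = 2 * L := by
    rw [show m * (2 * ν) = 2 * (m * ν) by ring, ← hL]; omega
  have hs2 : (m * (2 * ν) - 2) / 2 = L := by omega
  have e1 : Real.sin φ ^ (2 * (ν - 1)) * ∑ γ ∈ Finset.range ν, ((((ν - 1).choose γ : ℝ)) *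
          ∑ j ∈ Finset.range ((m * (2 * ν) - 2) / 2 + 1), (-1 : ℝ) ^ j * c (2 * j) *
            T ((m * (2 * ν) - 2) / 2) (2 * j) (m * (2 * ν) - 2 - 2 * j)) *
              (Real.cos φ / Real.sin φ) ^ (2 * γ) =
      ∑ j ∈ Finset.range (L + 1), (-1 : ℝ) ^ j * c (2 * j) * T L (2 * j) (2 * L - 2 * j) := by
    have := sin_pow_mul_sum_choose (n := ν - 1) (k := 0) (N := ν) (by omega) hs
    rw [add_zero, mul_zero, pow_zero] at this
    rw [hs2, hs1]
    simp only [mul_right_comm _ (∑ j ∈ Finset.range (L + 1), _)]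
    rw [← Finset.sum_mul, ← mul_assoc, this, one_mul]
  have e2 : Real.sin φ ^ (2 * (ν - 1)) * ∑ γ ∈ Finset.range ν,
        (∑ j ∈ Finset.range ((m * (2 * ν) - 2) / 2 + 1), ∑ α ∈ Finset.Icc 1 (ν - 1),
          ∑ β ∈ Finset.range (α + 1), M1 m (2 * ν) c γ j α β) *
            (Real.cos φ / Real.sin φ) ^ (2 * γ) =
      ∑ j ∈ Finset.range (L + 1), ∑ α ∈ Finset.Icc 1 (ν - 1), (-1) ^ j * c (2 * j) *
        (T (L + α * m) (2 * j) (2 * L - 2 * j) + T (L - α * m) (2 * j) (2 * L - 2 * j)) *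
          Real.cos (2 * α * φ) := by
    simp only [Finset.sum_mul]
    rw [Finset.sum_comm, Finset.mul_sum, hs2]
    refine Finset.sum_congr rfl fun j _ => ?_
    rw [Finset.sum_comm, Finset.mul_sum]
    refine Finset.sum_congr rfl fun α hα => ?_
    have hα := Finset.mem_Icc.1 hα
    rw [Finset.sum_comm, sin_pow_mul_sum_M1 m ν c hα.1 (by omega) hs, hs2, hs1]
  have e3 : Real.sin φ ^ (2 * (ν - 1)) * ∑ γ ∈ Finset.range ν,
        (∑ j ∈ Finset.range ((m * (2 * ν) - 2) / 2), ∑ α ∈ Finset.Icc 1 (ν - 1),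
          ∑ β ∈ Finset.range α, M2 m (2 * ν) c γ j α β) *
            (Real.cos φ / Real.sin φ) ^ (2 * γ + 1) =
      ∑ j ∈ Finset.range L, ∑ α ∈ Finset.Icc 1 (ν - 1), (-1) ^ j * c (2 * j + 1) *
        (T (L + α * m) (2 * j + 1) (2 * L - (2 * j + 1)) -
          T (L - α * m) (2 * j + 1) (2 * L - (2 * j + 1))) * Real.sin (2 * α * φ) := by
    simp only [Finset.sum_mul]
    rw [Finset.sum_comm, Finset.mul_sum, hs2]
    refine Finset.sum_congr rfl fun j _ => ?_
    rw [Finset.sum_comm, Finset.mul_sum]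
    refine Finset.sum_congr rfl fun α hα => ?_
    have hα := Finset.mem_Icc.1 hα
    rw [Finset.sum_comm, sin_pow_mul_sum_M2 m ν c (by omega) hs, hs2, hs1]
  rw [Jfun_eq m ν hν, mul_left_comm, mul_add (Real.sin φ ^ _),
    mul_add (Real.sin φ ^ _), e1, e2, e3, hs1, ← Finset.sum_add_distrib,
    mul_add, Finset.mul_sum, Finset.mul_sum]
  congr 1 <;> refine Finset.sum_congr rfl fun j _ => ?_
  · rw [mul_add, mul_add, mul_add, Finset.mul_sum, Finset.mul_sum, Finset.mul_sum]
    congr 1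
    · ring
    · exact Finset.sum_congr rfl fun α _ => by ring
  · rw [Finset.mul_sum, Finset.mul_sum, Finset.mul_sum]
    exact Finset.sum_congr rfl fun α _ => by ring

theorem Hpoly_eval (m p : ℕ) (a₀ : ℝ) (x : Fin p → ℂ) (t : ℝ) :
    (Hpoly m p a₀ x).eval t =
      ∑ l ∈ Finset.range (p + 1), (eC m p a₀ x l).re * t ^ (p - l) * 1 ^ l := by
  simp [Hpoly, Polynomial.eval_finsetSum]

theorem EpolyR_eval (m p : ℕ) (a₀ : ℝ) (x : Fin p → ℂ) (t : ℝ) :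
    (EpolyR m p a₀ x).eval t = ∑ l ∈ Finset.range (p + 1),
      (eC m p a₀ x l).re * (Ppoly m).eval t ^ (p - l) * (Qpoly m).eval t ^ l := by
  simp [EpolyR, Polynomial.eval_finsetSum]

theorem sum_homogeneous_mul (p : ℕ) (e : ℕ → ℝ) (u v k : ℝ) :
    ∑ l ∈ Finset.range (p + 1), e l * (u * k) ^ (p - l) * (v * k) ^ l =
      k ^ p * ∑ l ∈ Finset.range (p + 1), e l * u ^ (p - l) * v ^ l := by
  rw [Finset.mul_sum]
  refine Finset.sum_congr rfl fun l hl => ?_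
  rw [← Nat.sub_add_cancel (Nat.lt_succ_iff.1 (Finset.mem_range.1 hl)), pow_add,
    Nat.add_sub_cancel]
  ring

theorem sum_eC_re_ne_zero {m p : ℕ} (hm : Odd m) {a₀ : ℝ} (ha₀ : a₀ ≠ 0) {x : Fin p → ℂ}
    (hx : ∀ j, (x j).im ≠ 0) (he : ∀ l, ((eC m p a₀ x l).re : ℂ) = eC m p a₀ x l) {u v : ℝ}
    (huv : u ≠ 0 ∨ v ≠ 0) :
    ∑ l ∈ Finset.range (p + 1), (eC m p a₀ x l).re * u ^ (p - l) * v ^ l ≠ 0 := by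
  have h := sum_eC_mul (RingHom.id ℂ) m p a₀ x (fun j => eval_QmC_ne_zero hm (hx j)) u v
  simp only [RingHom.id_apply] at h
  intro h0
  have h1 : ((∑ l ∈ Finset.range (p + 1), (eC m p a₀ x l).re * u ^ (p - l) * v ^ l : ℝ) : ℂ) ≠
      0 := by
    push_cast
    simp only [he]
    rw [h]
    refine mul_ne_zero (pow_ne_zero _ (by exact_mod_cast ha₀)) (Finset.prod_ne_zero_iff.2 ?_)
    exact fun j _ => eval_QmC_mul_sub_ne_zero hm (hx j) huv
  exact h1 (by rw [h0, Complex.ofReal_zero])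

theorem dvd_EpolyR {m p : ℕ} (hm : Odd m) (A : Polynomial ℝ) {a₀ : ℝ} (ha₀ : a₀ ≠ 0)
    {x : Fin p → ℂ} (hA : A.map (algebraMap ℝ ℂ) =
      Polynomial.C (a₀ : ℂ) * ∏ j, (Polynomial.X - Polynomial.C (x j)))
    (hx : ∀ j, (x j).im ≠ 0) (he : ∀ l, ((eC m p a₀ x l).re : ℂ) = eC m p a₀ x l) :
    A ∣ EpolyR m p a₀ x := by
  rw [← Polynomial.map_dvd_map' (algebraMap ℝ ℂ), hA]
  have hE : (EpolyR m p a₀ x).map (algebraMap ℝ ℂ) = ∑ l ∈ Finset.range (p + 1),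
      Polynomial.C (eC m p a₀ x l) * PmC m ^ (p - l) * QmC m ^ l := by
    simp [EpolyR, Polynomial.map_sum, map_Ppoly, map_Qpoly, he]
  rw [hE, sum_eC_mul Polynomial.C m p a₀ x (fun j => eval_QmC_ne_zero hm (hx j))]
  have hu : IsUnit (Polynomial.C (a₀ : ℂ)) :=
    Polynomial.isUnit_C.2 (isUnit_iff_ne_zero.2 (by exact_mod_cast ha₀))
  rw [hu.mul_left_dvd]
  refine Dvd.dvd.mul_left (Finset.prod_dvd_prod_of_dvd _ _ fun j _ => ?_) _
  rw [Polynomial.dvd_iff_isRoot]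
  simp [mul_comm]

theorem natDegree_Ppoly_le (m : ℕ) : (Ppoly m).natDegree ≤ m :=
  Polynomial.natDegree_sum_le_of_forall_le _ _ fun _ _ =>
    (Polynomial.natDegree_C_mul_X_pow_le _ _).trans (Nat.sub_le _ _)

theorem natDegree_Qpoly_le (m : ℕ) : (Qpoly m).natDegree ≤ m :=
  Polynomial.natDegree_sum_le_of_forall_le _ _ fun _ _ =>
    (Polynomial.natDegree_C_mul_X_pow_le _ _).trans (Nat.sub_le _ _)

theorem natDegree_Bpoly_le (p : ℕ) (b : ℕ → ℝ) : (Bpoly p b).natDegree ≤ p - 2 :=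
  Polynomial.natDegree_sum_le_of_forall_le _ _ fun _ _ =>
    (Polynomial.natDegree_C_mul_X_pow_le _ _).trans (Nat.sub_le _ _)

theorem natDegree_EpolyR_le (m p : ℕ) (a₀ : ℝ) (x : Fin p → ℂ) :
    (EpolyR m p a₀ x).natDegree ≤ m * p := by
  refine Polynomial.natDegree_sum_le_of_forall_le _ _ fun l hl => ?_
  have h1 : (Ppoly m ^ (p - l)).natDegree ≤ (p - l) * m :=
    Polynomial.natDegree_pow_le_of_le _ (natDegree_Ppoly_le m)
  have h2 : (Qpoly m ^ l).natDegree ≤ l * m :=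
    Polynomial.natDegree_pow_le_of_le _ (natDegree_Qpoly_le m)
  have h3 := Polynomial.natDegree_mul_le_of_le
    (Polynomial.natDegree_mul_le_of_le (Polynomial.natDegree_C (eC m p a₀ x l).re).le h1) h2
  have h4 : 0 + (p - l) * m + l * m = m * p := by
    rw [zero_add, ← add_mul, Nat.sub_add_cancel (Nat.lt_succ_iff.1 (Finset.mem_range.1 hl)),
      mul_comm]
  exact h3.trans h4.le

theorem sum_range_two_mul_add_one_split (f : ℕ → ℝ) (L : ℕ) :
    ∑ k ∈ Finset.range (2 * L + 1), f k =
      ∑ j ∈ Finset.range (L + 1), f (2 * j) + ∑ j ∈ Finset.range L, f (2 * j + 1) := by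
  rw [Finset.sum_range_succ, Finset.sum_range_two_mul_eq, Finset.sum_range_succ]
  ring

theorem sin_pow_mul_eval_cot {q : Polynomial ℝ} {n : ℕ} (hq : q.natDegree ≤ n) {θ : ℝ}
    (hs : Real.sin θ ≠ 0) :
    Real.sin θ ^ n * q.eval (Real.cos θ / Real.sin θ) =
      ∑ k ∈ Finset.range (n + 1), q.coeff (n - k) * (Real.cos θ ^ (n - k) * Real.sin θ ^ k) := by
  rw [Polynomial.eval_eq_sum_range' (Nat.lt_succ_of_le hq), ← Finset.sum_range_reflect,
    Finset.mul_sum]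
  refine Finset.sum_congr rfl fun k hk => ?_
  have hk := Finset.mem_range.1 hk
  rw [show n.succ - 1 - k = n - k by omega, div_pow]
  have : Real.sin θ ^ n = Real.sin θ ^ (n - k) * Real.sin θ ^ k := by
    rw [← pow_add, Nat.sub_add_cancel (by omega)]
  rw [this]
  field_simp

theorem integral_sum_add_sum_mul (s t : Finset ℕ) (a b : ℕ → ℝ) {f h : ℕ → ℝ → ℝ} {g : ℝ → ℝ}
    (hf : ∀ j, Continuous (f j)) (hh : ∀ j, Continuous (h j)) (hg : Continuous g) {u v : ℝ} :
    ∫ θ in u..v, (∑ j ∈ s, a j * f j θ + ∑ j ∈ t, b j * h j θ) * g θ =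
      ∑ j ∈ s, a j * (∫ θ in u..v, f j θ * g θ) + ∑ j ∈ t, b j * ∫ θ in u..v, h j θ * g θ := by
  have heq : ∀ θ, (∑ j ∈ s, a j * f j θ + ∑ j ∈ t, b j * h j θ) * g θ =
      ∑ j ∈ s, a j * (f j θ * g θ) + ∑ j ∈ t, b j * (h j θ * g θ) := fun θ => by
    rw [add_mul, Finset.sum_mul, Finset.sum_mul]
    simp only [mul_assoc]
  simp only [heq]
  rw [intervalIntegral.integral_add, intervalIntegral.integral_finsetSum,
    intervalIntegral.integral_finsetSum]
  · simp only [intervalIntegral.integral_const_mul]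
  all_goals intros; apply Continuous.intervalIntegrable; fun_prop

/-- The Landen transformation in trigonometric form. -/
theorem integral_trig_landen {g : ℝ → ℝ} (hg : Continuous g)
    (hper : Function.Periodic g Real.pi) {m ν L : ℕ} (hm : m ≠ 0) (hν : 0 < ν)
    (hL : L + 1 = m * ν) (c : ℕ → ℝ) :
    ∫ θ in (0 : ℝ)..Real.pi, (∑ k ∈ Finset.range (2 * L + 1),
        c k * (Real.cos θ ^ (2 * L - k) * Real.sin θ ^ k)) * g (m * θ) =
      ∫ θ in (0 : ℝ)..Real.pi, Real.sin θ ^ (2 * (ν - 1)) *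
        Jfun m (2 * ν) c (Real.cos θ / Real.sin θ) * g θ := by
  rw [intervalIntegral.integral_of_le Real.pi_pos.le (f := fun θ => Real.sin θ ^ (2 * (ν - 1)) *
        Jfun m (2 * ν) c (Real.cos θ / Real.sin θ) * g θ),
    MeasureTheory.integral_Ioc_eq_integral_Ioo,
    MeasureTheory.setIntegral_congr_fun measurableSet_Ioo (fun θ hθ => congrArg (· * g θ)
      (sin_pow_mul_Jfun m ν L hν hL c (Real.sin_pos_of_mem_Ioo hθ).ne')),
    ← MeasureTheory.integral_Ioc_eq_integral_Ioo,
    ← intervalIntegral.integral_of_le Real.pi_pos.le]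
  simp only [sum_range_two_mul_add_one_split]
  rw [integral_sum_add_sum_mul _ _ _ _ (fun _ => by fun_prop) (fun _ => by fun_prop)
      (g := fun θ => g (m * θ)) (by fun_prop),
    integral_sum_add_sum_mul _ _ _ _ (fun _ => by fun_prop) (fun _ => by fun_prop) hg]
  congr 1 <;> refine Finset.sum_congr rfl fun j hj => ?_
  · exact congrArg _ (integral_cos_pow_mul_sin_pow_even hg hper hm hL
      (Nat.lt_succ_iff.1 (Finset.mem_range.1 hj)))
  · exact congrArg _ (integral_cos_pow_mul_sin_pow_odd hg hper hm hL (Finset.mem_range.1 hj))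
/-- Rational Landen transformation on `ℝ` (`p` even, `m` odd): with the `e_l` real
(first conjunct), `A ∣ E` (second conjunct), `Z = E/A`, `C = B·Z = Σ c_k x^{s−k}`,
`H = Σ e_l x^{p−l}` and `J` as above,
`∫_{−∞}^{∞} B(x)/A(x) dx = ∫_{−∞}^{∞} J(x)/H(x) dx`. -/
theorem stmt0 (p m : ℕ) (hp : 0 < p) (hpe : Even p) (hm : 0 < m) (hmo : Odd m)
    (a b : ℕ → ℝ) (ha0 : a 0 ≠ 0) (x : Fin p → ℂ)
    (hroots : (Apoly p a).map (algebraMap ℝ ℂ) =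
      Polynomial.C ((a 0 : ℂ)) * ∏ j, (Polynomial.X - Polynomial.C (x j)))
    (hnr : ∀ t : ℝ, (Apoly p a).eval t ≠ 0) :
    (∀ l ∈ Finset.range (p + 1), (eC m p (a 0) x l).im = 0) ∧
    (Apoly p a ∣ EpolyR m p (a 0) x) ∧
    (∫ t : ℝ, (Bpoly p b).eval t / (Apoly p a).eval t) =
      ∫ t : ℝ,
        Jfun m p
          (fun k => ((Bpoly p b) * (EpolyR m p (a 0) x / Apoly p a)).coeff (m * p - 2 - k)) t /
          (Hpoly m p (a 0) x).eval t := by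
  obtain ⟨ν, rfl⟩ : ∃ ν, p = 2 * ν := by
    obtain ⟨ν, h⟩ := hpe
    exact ⟨ν, by omega⟩
  have hν : 0 < ν := by omega
  obtain ⟨L, hL⟩ : ∃ L, L + 1 = m * ν := ⟨m * ν - 1, Nat.sub_add_cancel (Nat.mul_pos hm hν)⟩
  have hs1 : m * (2 * ν) = 2 * L + 2 := by
    rw [show m * (2 * ν) = 2 * (m * ν) by ring, ← hL]; ring
  have hx : ∀ j, (x j).im ≠ 0 := by
    intro j hj
    have h1 : ((Apoly (2 * ν) a).map (algebraMap ℝ ℂ)).eval (x j) = 0 := by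
      rw [hroots, Polynomial.eval_mul, Polynomial.eval_prod,
        Finset.prod_eq_zero (Finset.mem_univ j) (by simp), mul_zero]
    have h2 : x j = algebraMap ℝ ℂ (x j).re := Complex.ext (by simp) (by simp [hj])
    rw [h2, Polynomial.eval_map_algebraMap, Polynomial.aeval_algebraMap_apply_eq_algebraMap_eval]
      at h1
    exact hnr _ (by simpa using h1)
  have him := eC_im_eq_zero m (2 * ν) (a 0) x (map_conj_roots _ _ ha0 x hroots)
  have he : ∀ l, ((eC m (2 * ν) (a 0) x l).re : ℂ) = eC m (2 * ν) (a 0) x l := fun l =>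
    Complex.ext (by simp) (by simp [him l])
  have hdvd := dvd_EpolyR hmo (Apoly (2 * ν) a) ha0 hroots hx he
  refine ⟨fun l _ => him l, hdvd, ?_⟩
  have hA0 : Apoly (2 * ν) a ≠ 0 := fun h => hnr 0 (by rw [h, Polynomial.eval_zero])
  have hAZ := EuclideanDomain.mul_div_cancel' hA0 hdvd
  set Z := EpolyR m (2 * ν) (a 0) x / Apoly (2 * ν) a with hZ
  set G : ℝ → ℝ → ℝ := fun u v => ∑ l ∈ Finset.range (2 * ν + 1),
    (eC m (2 * ν) (a 0) x l).re * u ^ (2 * ν - l) * v ^ l with hG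
  have hG0 : ∀ u v : ℝ, u ≠ 0 ∨ v ≠ 0 → G u v ≠ 0 := fun u v huv =>
    sum_eC_re_ne_zero hmo ha0 hx he huv
  have hGmul : ∀ u v k : ℝ, G (u * k) (v * k) = k ^ (2 * ν) * G u v := fun u v k =>
    sum_homogeneous_mul _ _ u v k
  have hGtrig : ∀ θ : ℝ, G (Real.cos θ) (Real.sin θ) ≠ 0 := fun θ => hG0 _ _ <| by
    by_contra! h
    have := Real.sin_sq_add_cos_sq θ
    simp [h.1, h.2] at this
  have hE0 : ∀ t, (EpolyR m (2 * ν) (a 0) x).eval t ≠ 0 := fun t => by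
    rw [EpolyR_eval]
    exact hG0 _ _ (eval_Ppoly_ne_zero_or hmo t)
  have hZ0 : Z ≠ 0 := by
    rintro h
    rw [h, mul_zero] at hAZ
    exact hE0 0 (by rw [← hAZ, Polynomial.eval_zero])
  have hdegA : (Apoly (2 * ν) a).natDegree = 2 * ν := by
    rw [← Polynomial.natDegree_map (algebraMap ℝ ℂ), hroots,
      Polynomial.natDegree_C_mul (by exact_mod_cast ha0),
      Polynomial.natDegree_prod_of_monic _ _ fun j _ => Polynomial.monic_X_sub_C _]
    simp
  have hdeg : (Bpoly (2 * ν) b * Z).natDegree ≤ 2 * L := by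
    have h1 := natDegree_EpolyR_le m (2 * ν) (a 0) x
    rw [← hAZ, Polynomial.natDegree_mul hA0 hZ0, hdegA] at h1
    have h2 := Polynomial.natDegree_mul_le (p := Bpoly (2 * ν) b) (q := Z)
    have h3 := natDegree_Bpoly_le (2 * ν) b
    omega
  have hgc : Continuous fun θ => (G (Real.cos θ) (Real.sin θ))⁻¹ := by
    refine Continuous.inv₀ ?_ hGtrig
    simp only [hG]
    fun_prop
  have hgp : Function.Periodic (fun θ => (G (Real.cos θ) (Real.sin θ))⁻¹) Real.pi := by
    intro θ
    have := hGmul (Real.cos θ) (Real.sin θ) (-1)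
    simp only [mul_neg_one, pow_mul, neg_one_sq, one_pow, one_mul] at this
    simp only [Real.cos_add_pi, Real.sin_add_pi, this]
  have key := integral_trig_landen hgc hgp hm.ne' hν hL
    (fun k => (Bpoly (2 * ν) b * Z).coeff (m * (2 * ν) - 2 - k))
  rw [integral_univ_eq_integral_cot, integral_univ_eq_integral_cot]
  refine Eq.trans ?_ (key.trans ?_) <;>
    rw [intervalIntegral.integral_of_le Real.pi_pos.le,
      intervalIntegral.integral_of_le Real.pi_pos.le, MeasureTheory.integral_Ioc_eq_integral_Ioo,
      MeasureTheory.integral_Ioc_eq_integral_Ioo] <;>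
    refine MeasureTheory.setIntegral_congr_fun measurableSet_Ioo fun θ hθ => ?_ <;>
    have hs := (Real.sin_pos_of_mem_Ioo hθ).ne'
  · obtain ⟨hP, hQ⟩ := eval_cot_mul_sin_pow hmo hs
    have h1 := sin_pow_mul_eval_cot hdeg hs
    have h2 : Real.sin θ ^ (2 * L + 2) *
        (EpolyR m (2 * ν) (a 0) x).eval (Real.cos θ / Real.sin θ) =
        G (Real.cos (m * θ)) (Real.sin (m * θ)) := by
      rw [EpolyR_eval, ← hP, ← hQ, hGmul, ← pow_mul, hs1]
    have h3 := hE0 (Real.cos θ / Real.sin θ)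
    rw [show m * (2 * ν) - 2 = 2 * L by omega, ← h1, ← h2]
    rw [← hAZ, Polynomial.eval_mul] at h3 ⊢
    rw [Polynomial.eval_mul]
    have h4 := left_ne_zero_of_mul h3
    have h5 := right_ne_zero_of_mul h3
    field_simp
    ring
  · have h2 : Real.sin θ ^ (2 * (ν - 1) + 2) *
        (Hpoly m (2 * ν) (a 0) x).eval (Real.cos θ / Real.sin θ) =
        G (Real.cos θ) (Real.sin θ) := by
      have h3 := hGmul (Real.cos θ / Real.sin θ) 1 (Real.sin θ)
      rw [div_mul_cancel₀ _ hs, one_mul] at h3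
      rw [h3, Hpoly_eval, show 2 * (ν - 1) + 2 = 2 * ν by omega]
    have h3 := hGtrig θ
    rw [← h2] at h3 ⊢
    have h4 := right_ne_zero_of_mul h3
    field_simp
    ring
end

section
/- Let m be a positive integer. The polynomial P_m has exactly m zeros, all real and simple, namely the m distinct numbers p_k = cot((2k+1)π/(2m)) for 0 ≤ k ≤ m−1; that is, P_m(x) = Π_{k=0}^{m−1} (x − cot((2k+1)π/(2m))). -/
open Real

/-- `P_m(x) = Σ_{j=0}^{⌊m/2⌋} (−1)^j C(m,2j) x^{m−2j}`; it is monic of degree `m`. -/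
noncomputable def Pm (m : ℕ) (x : ℝ) : ℝ :=
  ∑ j ∈ Finset.range (m / 2 + 1), (-1 : ℝ) ^ j * (m.choose (2 * j)) * x ^ (m - 2 * j)

lemma sum_range_two_mul {M : Type*} [AddCommMonoid M] (f : ℕ → M) (n : ℕ) :
    ∑ k ∈ Finset.range (2 * n), f k = ∑ j ∈ Finset.range n, (f (2 * j) + f (2 * j + 1)) := by
  induction n with
  | zero => simp
  | succ n ih => rw [Finset.sum_range_succ, ← ih, mul_add, mul_one, Finset.sum_range_succ,
      Finset.sum_range_succ, add_assoc]

lemma Pm_eq_re (m : ℕ) (x : ℝ) : Pm m x = (((x : ℂ) + Complex.I) ^ m).re := by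
  have hsub : Finset.range (m + 1) ⊆ Finset.range (2 * (m / 2 + 1)) :=
    Finset.range_subset_range.2 (by omega)
  rw [add_comm, add_pow, Finset.sum_subset hsub, sum_range_two_mul, Complex.re_sum, Pm]
  · refine Finset.sum_congr rfl fun j _ => ?_
    have heven : Complex.I ^ (2 * j) * (x : ℂ) ^ (m - 2 * j) * (m.choose (2 * j) : ℂ) =
        (((-1) ^ j * (m.choose (2 * j)) * x ^ (m - 2 * j) : ℝ) : ℂ) := by
      rw [pow_mul, Complex.I_sq]
      push_cast
      ring
    have hodd : Complex.I ^ (2 * j + 1) * (x : ℂ) ^ (m - (2 * j + 1)) *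
          (m.choose (2 * j + 1) : ℂ) =
        (((-1) ^ j * (m.choose (2 * j + 1)) * x ^ (m - (2 * j + 1)) : ℝ) : ℂ) * Complex.I := by
      rw [pow_succ, pow_mul, Complex.I_sq]
      push_cast
      ring
    rw [heven, hodd, Complex.add_re, Complex.ofReal_re, Complex.re_ofReal_mul, Complex.I_re,
      mul_zero, add_zero]
  · intro k _ hk
    rw [Nat.choose_eq_zero_of_lt (by simpa using hk), Nat.cast_zero, mul_zero]

lemma sin_pow_mul_Pm_cot (m : ℕ) {θ : ℝ} (hθ : sin θ ≠ 0) :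
    sin θ ^ m * Pm m (Real.cot θ) = cos (m * θ) := by
  have hθ' : Complex.sin θ ≠ 0 := by exact_mod_cast hθ
  have h : ((sin θ ^ m : ℝ) : ℂ) * ((Real.cot θ : ℂ) + Complex.I) ^ m =
      Complex.cos (m * θ) + Complex.sin (m * θ) * Complex.I := by
    rw [← Complex.cos_add_sin_mul_I_pow, Real.cot_eq_cos_div_sin]
    push_cast
    rw [← mul_pow]
    congr 1
    field_simp
  rw [Pm_eq_re, ← Complex.re_ofReal_mul, h]
  have hc : Complex.cos (m * θ) = ((cos (m * θ) : ℝ) : ℂ) := by push_cast; rfl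
  have hs : Complex.sin (m * θ) = ((sin (m * θ) : ℝ) : ℂ) := by push_cast; rfl
  rw [hc, hs]
  simp [-Complex.ofReal_cos, -Complex.ofReal_sin]

lemma injOn_cot : Set.InjOn Real.cot (Set.Ioo 0 π) := by
  intro a ha b hb h
  have hsa := (sin_pos_of_mem_Ioo ha).ne'
  have hsb := (sin_pos_of_mem_Ioo hb).ne'
  rw [Real.cot_eq_cos_div_sin, Real.cot_eq_cos_div_sin, div_eq_div_iff hsa hsb] at h
  have h0 : sin (a - b) = 0 := by rw [sin_sub]; linarith
  have := (sin_eq_zero_iff_of_lt_of_lt (by linarith [ha.1, hb.2]) (by linarith [ha.2, hb.1])).1 h0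
  linarith

lemma odd_mul_pi_div_mem_Ioo {m k : ℕ} (hk : k < m) :
    (2 * k + 1) * π / (2 * m) ∈ Set.Ioo 0 π := by
  have hm : (0 : ℝ) < m := by exact_mod_cast (Nat.zero_le k).trans_lt hk
  have hk' : (k : ℝ) + 1 ≤ m := by exact_mod_cast hk
  refine ⟨by positivity, ?_⟩
  rw [div_lt_iff₀ (by positivity)]
  nlinarith [pi_pos]

lemma injOn_cot_odd_mul_pi_div (m : ℕ) :
    Set.InjOn (fun k : ℕ => Real.cot ((2 * k + 1) * π / (2 * m)))
      (Finset.range m : Finset ℕ) := by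
  intro a ha b hb h
  have ha' : a < m := by simpa using ha
  have hb' : b < m := by simpa using hb
  have hm : (m : ℝ) ≠ 0 := by exact_mod_cast (Nat.zero_le a).trans_lt ha' |>.ne'
  have h' := injOn_cot (odd_mul_pi_div_mem_Ioo ha') (odd_mul_pi_div_mem_Ioo hb') h
  have hpi := pi_ne_zero
  field_simp at h'
  have : (a : ℝ) = b := by linarith
  exact_mod_cast this

lemma Pm_cot_eq_zero {m k : ℕ} (hk : k < m) :
    Pm m (Real.cot ((2 * k + 1) * π / (2 * m))) = 0 := by
  have hm : (m : ℝ) ≠ 0 := by exact_mod_cast (Nat.zero_le k).trans_lt hk |>.ne'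
  have hs := (sin_pos_of_mem_Ioo (odd_mul_pi_div_mem_Ioo hk)).ne'
  have h := sin_pow_mul_Pm_cot m hs
  have hcos : cos (m * ((2 * k + 1) * π / (2 * m))) = 0 :=
    cos_eq_zero_iff.2 ⟨k, by push_cast; field_simp⟩
  rw [hcos] at h
  exact (mul_eq_zero.1 h).resolve_left (pow_ne_zero _ hs)

/-- `Pm m` as an element of `ℝ[X]`. -/
noncomputable def PmPoly (m : ℕ) : Polynomial ℝ :=
  ∑ j ∈ Finset.range (m / 2 + 1),
    Polynomial.C ((-1 : ℝ) ^ j * (m.choose (2 * j))) * Polynomial.X ^ (m - 2 * j)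

lemma eval_PmPoly (m : ℕ) (x : ℝ) : (PmPoly m).eval x = Pm m x := by
  simp only [PmPoly, Pm, Polynomial.eval_finsetSum, Polynomial.eval_mul, Polynomial.eval_C,
    Polynomial.eval_pow, Polynomial.eval_X]

lemma exists_PmPoly_eq_X_pow_add (m : ℕ) :
    ∃ q : Polynomial ℝ, q.degree < m ∧ PmPoly m = Polynomial.X ^ m + q := by
  refine ⟨∑ j ∈ Finset.range (m / 2), Polynomial.C ((-1 : ℝ) ^ (j + 1) *
    (m.choose (2 * (j + 1)))) * Polynomial.X ^ (m - 2 * (j + 1)), ?_, ?_⟩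
  · refine (Polynomial.degree_sum_le _ _).trans_lt
      ((Finset.sup_lt_iff (WithBot.bot_lt_coe m)).2 fun j hj => ?_)
    refine (Polynomial.degree_C_mul_X_pow_le _ _).trans_lt ?_
    rw [Finset.mem_range] at hj
    exact WithBot.coe_lt_coe.2 (by simp only [Nat.cast_id]; omega)
  · rw [PmPoly, Finset.sum_range_succ', add_comm]
    simp

lemma PmPoly_eq_prod (m : ℕ) :
    PmPoly m = ∏ k ∈ Finset.range m,
      (Polynomial.X - Polynomial.C (Real.cot ((2 * k + 1) * π / (2 * m)))) := by
  obtain ⟨q, hq, h⟩ := exists_PmPoly_eq_X_pow_add m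
  have hmonic : (PmPoly m).Monic := h ▸ Polynomial.monic_X_pow_add hq
  have hdeg : (PmPoly m).degree = m := by
    rw [h, Polynomial.degree_add_eq_left_of_degree_lt (by rwa [Polynomial.degree_X_pow]),
      Polynomial.degree_X_pow]
  have hprod : (∏ k ∈ Finset.range m,
      (Polynomial.X - Polynomial.C (Real.cot ((2 * k + 1) * π / (2 * m))))).Monic :=
    Polynomial.monic_prod_X_sub_C _ _
  refine Polynomial.eq_of_degree_le_of_eval_index_eq (Finset.range m)
    (injOn_cot_odd_mul_pi_div m) ?_ ?_ (hmonic.leadingCoeff.trans hprod.leadingCoeff.symm) ?_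
  · rw [hdeg, Finset.card_range]
  · rw [hdeg, Polynomial.degree_prod]
    simp
  · intro k hk
    rw [eval_PmPoly, Pm_cot_eq_zero (Finset.mem_range.1 hk), Polynomial.eval_prod]
    exact (Finset.prod_eq_zero hk (by simp)).symm

/-- The polynomial `P_m` has exactly `m` zeros, all real and simple, namely the `m`
distinct numbers `p_k = cot((2k+1)π/(2m))`, `0 ≤ k ≤ m−1`; that is,
`P_m(x) = Π_{k=0}^{m−1} (x − cot((2k+1)π/(2m)))`. -/
theorem stmt4 (m : ℕ) (hm : 0 < m) :
    (∀ x : ℝ, Pm m x =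
        ∏ k ∈ Finset.range m, (x - Real.cot ((2 * k + 1) * π / (2 * m)))) ∧
      Set.InjOn (fun k : ℕ => Real.cot ((2 * k + 1) * π / (2 * m)))
        (Finset.range m : Finset ℕ) := by
  refine ⟨fun x => ?_, injOn_cot_odd_mul_pi_div m⟩
  rw [← eval_PmPoly, PmPoly_eq_prod, Polynomial.eval_prod]
  simp only [Polynomial.eval_sub, Polynomial.eval_X, Polynomial.eval_C]
end

section
/- Let a be an odd nonnegative integer and b an even nonnegative integer, set c = (a+b+1)/2 and d = ⌊a/2⌋ = (a−1)/2, and let u be a real number. Then sin^a u · cos^b u = ((−1)^d / 2^{a+b}) · Σ_{j=1}^{c} ( T_{c−1+j}(a,b) − T_{c−j}(a,b) ) · sin((2j−1)u). -/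
open Polynomial in
theorem coeff_X_sub_one_pow_mul_X_add_one_pow (a b x : ℕ) :
    ((X - 1 : ℝ[X]) ^ a * (X + 1) ^ b).coeff x = T x a b := by
  rw [mul_comm, coeff_mul, Finset.Nat.sum_antidiagonal_eq_sum_range_succ
    (fun i j => ((X + 1 : ℝ[X]) ^ b).coeff i * ((X - 1 : ℝ[X]) ^ a).coeff j), T]
  refine Finset.sum_congr rfl fun j hj => ?_
  have hj : j ≤ x := Nat.lt_succ_iff.mp (Finset.mem_range.mp hj)
  rw [coeff_X_add_one_pow, sub_eq_add_neg, ← C_1, ← C_neg, coeff_X_add_C_pow]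
  by_cases h : x - j ≤ a
  · have hexp : (a : ℤ) - x + j = ((a - (x - j) : ℕ) : ℤ) := by omega
    rw [hexp, zpow_natCast]
    ring
  · simp [Nat.choose_eq_zero_of_lt (not_le.mp h)]

open Polynomial in
theorem sum_range_T_mul_pow (a b : ℕ) (z : ℂ) :
    ∑ x ∈ Finset.range (a + b + 1), (T x a b : ℂ) * z ^ x = (z - 1) ^ a * (z + 1) ^ b := by
  have hdeg : ((X - 1 : ℝ[X]) ^ a * (X + 1) ^ b).natDegree < a + b + 1 := by
    rw [← C_1]
    refine Nat.lt_succ_of_le (natDegree_mul_le.trans ?_)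
    rw [natDegree_pow, natDegree_pow, natDegree_X_sub_C, natDegree_X_add_C, mul_one, mul_one]
  have h := aeval_eq_sum_range' hdeg z
  simp only [coeff_X_sub_one_pow_mul_X_add_one_pow, Complex.real_smul] at h
  simpa using h.symm

theorem sum_range_T_mul_exp (a b : ℕ) (u : ℝ) :
    ∑ x ∈ Finset.range (a + b + 1),
        (T x a b : ℂ) * Complex.exp (((2 * x - (a + b : ℕ)) * u : ℝ) * Complex.I) =
      Complex.I ^ a * ((2 ^ (a + b) * (Real.sin u ^ a * Real.cos u ^ b) : ℝ) : ℂ) := by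
  set z := Complex.exp (u * Complex.I) with hz
  have hz0 : z ≠ 0 := Complex.exp_ne_zero _
  have hz_eq : z = Complex.cos u + Complex.sin u * Complex.I := Complex.exp_mul_I _
  have hsub : z ^ 2 - 1 = z * (2 * Complex.I * Complex.sin u) := by
    rw [hz_eq]
    linear_combination Complex.sin_sq_add_cos_sq (u : ℂ) -
      Complex.sin u ^ 2 * Complex.I_sq
  have hadd : z ^ 2 + 1 = z * (2 * Complex.cos u) := by
    rw [hz_eq]
    linear_combination -Complex.sin_sq_add_cos_sq (u : ℂ) +
      Complex.sin u ^ 2 * Complex.I_sq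
  have h := sum_range_T_mul_pow a b (z ^ 2)
  apply mul_left_cancel₀ (pow_ne_zero (a + b) hz0)
  calc _ = ∑ x ∈ Finset.range (a + b + 1), (T x a b : ℂ) * (z ^ 2) ^ x := by
        rw [Finset.mul_sum]
        refine Finset.sum_congr rfl fun x _ => ?_
        rw [mul_left_comm, ← pow_mul, hz, ← Complex.exp_nat_mul, ← Complex.exp_nat_mul,
          ← Complex.exp_add]
        congr 2
        push_cast
        ring
    _ = _ := by
        rw [h, hsub, hadd]
        push_cast
        ring

theorem sum_range_T_mul_sin {a : ℕ} (ha : Odd a) (b : ℕ) (u : ℝ) :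
    ∑ x ∈ Finset.range (a + b + 1), T x a b * Real.sin ((2 * x - (a + b : ℕ)) * u) =
      (-1) ^ (a / 2) * (2 ^ (a + b) * (Real.sin u ^ a * Real.cos u ^ b)) := by
  have hI : Complex.I ^ a = ((-1) ^ (a / 2) : ℝ) * Complex.I := by
    conv_lhs => rw [← Nat.two_mul_div_two_add_one_of_odd ha]
    rw [pow_succ, pow_mul, Complex.I_sq]
    push_cast
    rfl
  have h := congrArg Complex.im (sum_range_T_mul_exp a b u)
  rw [hI, mul_right_comm, ← Complex.ofReal_mul, Complex.im_ofReal_mul, Complex.I_im, mul_one,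
    Complex.im_sum] at h
  simpa only [Complex.im_ofReal_mul, Complex.exp_ofReal_mul_I_im] using h

theorem sum_range_two_mul_eq_sum_Icc {M : Type*} [AddCommMonoid M] (f : ℕ → M) (c : ℕ) :
    ∑ x ∈ Finset.range (2 * c), f x = ∑ j ∈ Finset.Icc 1 c, (f (c - 1 + j) + f (c - j)) := by
  rw [two_mul, Finset.sum_range_add, ← Finset.sum_range_reflect f, ← Finset.sum_add_distrib,
    ← Finset.Ico_add_one_right_eq_Icc, Finset.sum_Ico_eq_sum_range, Nat.add_sub_cancel]
  refine Finset.sum_congr rfl fun j hj => ?_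
  have hj := Finset.mem_range.mp hj
  rw [add_comm, show c - 1 + (1 + j) = c + j by omega, show c - (1 + j) = c - 1 - j by omega]

/-- For `a` odd and `b` even, with `c = (a+b+1)/2` and `d = ⌊a/2⌋ = (a−1)/2`:
`sin^a u cos^b u = ((−1)^d/2^{a+b}) Σ_{j=1}^{c} (T_{c−1+j}(a,b)−T_{c−j}(a,b)) sin((2j−1)u)`. -/
theorem stmt10 (a b : ℕ) (ha : Odd a) (hb : Even b) (u : ℝ) :
    Real.sin u ^ a * Real.cos u ^ b =
      ((-1 : ℝ) ^ (a / 2) / 2 ^ (a + b)) *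
        ∑ j ∈ Finset.Icc 1 ((a + b + 1) / 2),
          (T ((a + b + 1) / 2 - 1 + j) a b - T ((a + b + 1) / 2 - j) a b) *
            Real.sin ((2 * (j : ℝ) - 1) * u) := by
  set c := (a + b + 1) / 2
  have hc : a + b + 1 = 2 * c := by
    have := (ha.add_even hb).add_one
    exact (Nat.two_mul_div_two_of_even this).symm
  have hcR : ((a + b : ℕ) : ℝ) = 2 * c - 1 := by
    rw [eq_sub_iff_add_eq]
    exact_mod_cast hc
  have hsum : ∑ j ∈ Finset.Icc 1 c,
      (T (c - 1 + j) a b - T (c - j) a b) * Real.sin ((2 * (j : ℝ) - 1) * u) =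
      (-1) ^ (a / 2) * (2 ^ (a + b) * (Real.sin u ^ a * Real.cos u ^ b)) := by
    rw [← sum_range_T_mul_sin ha, hc, sum_range_two_mul_eq_sum_Icc]
    refine Finset.sum_congr rfl fun j hj => ?_
    obtain ⟨hj1, hjc⟩ := Finset.mem_Icc.mp hj
    rw [hcR, Nat.cast_add, Nat.cast_sub (hj1.trans hjc), Nat.cast_sub hjc, Nat.cast_one,
      show (2 * ((c : ℝ) - 1 + j) - (2 * c - 1)) * u = (2 * j - 1) * u by ring,
      show (2 * ((c : ℝ) - j) - (2 * c - 1)) * u = -((2 * j - 1) * u) by ring, Real.sin_neg]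
    ring
  have hsign : (-1 : ℝ) ^ (a / 2) * (-1) ^ (a / 2) = 1 := by
    rw [← mul_pow]
    norm_num
  rw [hsum, div_mul_eq_mul_div, ← mul_assoc, hsign, one_mul, mul_div_cancel_left₀ _ (by positivity)]
end

section
/- Let m, p, k be positive integers such that m does not divide k, and let e_0, e_1, …, e_p be real numbers such that ET_{m,p}(θ) := Σ_{l=0}^{p} e_l cos^{p−l}(mθ) sin^{l}(mθ) is nonzero for every real θ. Then ∫_0^{2π} sin(kθ)/ET_{m,p}(θ) dθ = 0 and ∫_0^{2π} cos(kθ)/ET_{m,p}(θ) dθ = 0. -/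
open Real

/-- `ET_{m,p}(θ) = Σ_{l=0}^{p} e_l cos^{p−l}(mθ) sin^{l}(mθ)`. -/
noncomputable def ET (m p : ℕ) (e : ℕ → ℝ) (θ : ℝ) : ℝ :=
  ∑ l ∈ Finset.range (p + 1),
    e l * Real.cos (m * θ) ^ (p - l) * Real.sin (m * θ) ^ l

theorem continuous_ET (m p : ℕ) (e : ℕ → ℝ) : Continuous (ET m p e) := by
  unfold ET
  fun_prop

theorem ET_add_nat_period (m p n : ℕ) (e : ℕ → ℝ) (a θ : ℝ) (ha : m * a = n * (2 * π)) :
    ET m p e (θ + a) = ET m p e θ := by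
  simp only [ET, mul_add, ha, Real.cos_add_nat_mul_two_pi, Real.sin_add_nat_mul_two_pi]

theorem ET_periodic_two_pi (m p : ℕ) (e : ℕ → ℝ) : Function.Periodic (ET m p e) (2 * π) :=
  fun θ => ET_add_nat_period m p m e (2 * π) θ rfl

/-- A full-period integral is invariant under translation of the integrand. -/
theorem Function.Periodic.integral_comp_add_right {f : ℝ → ℝ} {T : ℝ}
    (hf : Function.Periodic f T) (a : ℝ) :
    ∫ x in (0:ℝ)..T, f (x + a) = ∫ x in (0:ℝ)..T, f x := by
  rw [intervalIntegral.integral_comp_add_right, add_comm T a, zero_add,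
    hf.intervalIntegral_add_eq a 0, zero_add]

theorem cos_nat_mul_two_pi_div_ne_one {m k : ℕ} (hm : 0 < m) (hnd : ¬ m ∣ k) :
    Real.cos (k * (2 * π / m)) ≠ 1 := by
  intro h
  obtain ⟨n, hn⟩ := (Real.cos_eq_one_iff _).1 h
  have hm' : (m : ℝ) ≠ 0 := by positivity
  have hkn : (m : ℝ) * n = k := by
    field_simp at hn
    linarith
  exact hnd (Int.natCast_dvd_natCast.1 ⟨n, by exact_mod_cast hkn.symm⟩)

/-- A vector fixed by a nontrivial rotation is zero. -/
theorem eq_zero_of_rotation_fixed {a S C : ℝ} (ha : Real.cos a ≠ 1)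
    (hS : S = Real.cos a * S + Real.sin a * C) (hC : C = Real.cos a * C - Real.sin a * S) :
    S = 0 ∧ C = 0 := by
  have h1 : 1 - Real.cos a ≠ 0 := sub_ne_zero.2 ha.symm
  have h2 := Real.sin_sq_add_cos_sq a
  constructor
  · refine (mul_eq_zero.1 ?_).resolve_left h1
    linear_combination ((1 - Real.cos a) * hS + Real.sin a * hC - S * h2) / 2
  · refine (mul_eq_zero.1 ?_).resolve_left h1
    linear_combination ((1 - Real.cos a) * hC - Real.sin a * hS - C * h2) / 2

/-- If `m` does not divide `k` and `ET_{m,p}` never vanishes, then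
`∫_0^{2π} sin(kθ)/ET_{m,p}(θ) dθ = 0` and `∫_0^{2π} cos(kθ)/ET_{m,p}(θ) dθ = 0`. -/
theorem stmt12 (m p k : ℕ) (hm : 0 < m) (hp : 0 < p) (hk : 0 < k)
    (hnd : ¬ m ∣ k) (e : ℕ → ℝ) (hET : ∀ θ : ℝ, ET m p e θ ≠ 0) :
    (∫ θ in (0:ℝ)..(2 * π), Real.sin (k * θ) / ET m p e θ) = 0 ∧
      (∫ θ in (0:ℝ)..(2 * π), Real.cos (k * θ) / ET m p e θ) = 0 := by
  set a : ℝ := 2 * π / m with ha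
  have hm' : (m : ℝ) ≠ 0 := by positivity
  have hshift (θ : ℝ) : ET m p e (θ + a) = ET m p e θ :=
    ET_add_nat_period m p 1 e a θ (by rw [ha]; field_simp; simp)
  have hper := ET_periodic_two_pi m p e
  have hsin : Function.Periodic (fun θ => Real.sin (k * θ) / ET m p e θ) (2 * π) := fun θ => by
    simp only [mul_add, Real.sin_add_nat_mul_two_pi, hper θ]
  have hcos : Function.Periodic (fun θ => Real.cos (k * θ) / ET m p e θ) (2 * π) := fun θ => by
    simp only [mul_add, Real.cos_add_nat_mul_two_pi, hper θ]
  have hET_cont := continuous_ET m p e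
  have hsin_int : IntervalIntegrable (fun θ => Real.sin (k * θ) / ET m p e θ)
      MeasureTheory.volume 0 (2 * π) :=
    ((by fun_prop : Continuous fun θ : ℝ => Real.sin (k * θ)).div
      hET_cont hET).intervalIntegrable _ _
  have hcos_int : IntervalIntegrable (fun θ => Real.cos (k * θ) / ET m p e θ)
      MeasureTheory.volume 0 (2 * π) :=
    ((by fun_prop : Continuous fun θ : ℝ => Real.cos (k * θ)).div
      hET_cont hET).intervalIntegrable _ _
  refine eq_zero_of_rotation_fixed (cos_nat_mul_two_pi_div_ne_one hm hnd) ?_ ?_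
  · rw [← intervalIntegral.integral_const_mul, ← intervalIntegral.integral_const_mul,
      ← intervalIntegral.integral_add (hsin_int.const_mul _) (hcos_int.const_mul _),
      ← hsin.integral_comp_add_right a]
    congr 1 with θ
    rw [hshift, mul_add, Real.sin_add]
    ring
  · rw [← intervalIntegral.integral_const_mul, ← intervalIntegral.integral_const_mul,
      ← intervalIntegral.integral_sub (hcos_int.const_mul _) (hsin_int.const_mul _),
      ← hcos.integral_comp_add_right a]
    congr 1 with θ
    rw [hshift, mul_add, Real.cos_add]
    ring
end

section
/- Let α be a positive integer. Then, as an identity of polynomials in the real variable y, P_{2α}(y) = Σ_{β=0}^{α} (−1)^{α−β} · (α/(2α−β)) · 2^{2(α−β)} · binom(2α−β, β) · (1 + y²)^{β}. -/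
/-- The Fibonacci polynomial `Σ_{i+j=m} C(i,j) q^j s^(i-j)` in two variables. -/
def fibPoly {R : Type*} [CommRing R] (s q : R) (m : ℕ) : R :=
  ∑ p ∈ Finset.HasAntidiagonal.antidiagonal m, (p.1.choose p.2 : R) * q ^ p.2 * s ^ (p.1 - p.2)

theorem fibPoly_add_two {R : Type*} [CommRing R] (s q : R) (m : ℕ) :
    fibPoly s q (m + 2) = s * fibPoly s q (m + 1) + q * fibPoly s q m := by
  unfold fibPoly
  rw [Finset.Nat.antidiagonal_succ_succ', Finset.Nat.antidiagonal_succ']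
  simp only [Finset.sum_cons, Finset.sum_map, Finset.mul_sum, mul_add,
    Function.Embedding.prodMap, Function.Embedding.coeFn_mk, Prod.map, Function.Embedding.refl_apply]
  have h : ∀ p ∈ Finset.HasAntidiagonal.antidiagonal m,
      ((p.1.succ.choose p.2.succ : ℕ) : R) * q ^ p.2.succ * s ^ (p.1.succ - p.2.succ) =
        s * ((p.1.choose p.2.succ : R) * q ^ p.2.succ * s ^ (p.1 - p.2.succ)) +
          q * ((p.1.choose p.2 : R) * q ^ p.2 * s ^ (p.1 - p.2)) := by
    rintro ⟨i, j⟩ -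
    simp only [Nat.succ_eq_add_one, Nat.choose_succ_succ, Nat.cast_add, Nat.add_sub_add_right]
    rcases lt_or_ge i (j + 1) with hij | hij
    · rw [Nat.choose_eq_zero_of_lt hij]
      push_cast
      ring
    · obtain ⟨k, rfl⟩ := Nat.exists_eq_add_of_le hij
      rw [show j + 1 + k - j = k + 1 by omega, show j + 1 + k - (j + 1) = k by omega]
      ring
  rw [Finset.sum_congr rfl h, Finset.sum_add_distrib]
  simp
  ring

theorem pow_add_pow_eq_fibPoly {R : Type*} [CommRing R] (a b : R) (m : ℕ) :
    a ^ (m + 2) + b ^ (m + 2) =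
      fibPoly (a + b) (-(a * b)) (m + 2) + -(a * b) * fibPoly (a + b) (-(a * b)) m := by
  have h0 : fibPoly (a + b) (-(a * b)) 0 = 1 := by simp [fibPoly]
  have h1 : fibPoly (a + b) (-(a * b)) 1 = a + b := by
    simp [fibPoly, Finset.Nat.antidiagonal_succ]
  induction m using Nat.twoStepInduction with
  | zero => rw [fibPoly_add_two, h0, zero_add, h1]; ring
  | one => rw [fibPoly_add_two, fibPoly_add_two, h0, zero_add, h1]; ring
  | more m ih ih' =>
    rw [fibPoly_add_two _ _ (m + 2)]
    rw [show fibPoly (a + b) (-(a * b)) (m + 2 + 1) =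
      a ^ (m + 1 + 2) + b ^ (m + 1 + 2) - -(a * b) * fibPoly (a + b) (-(a * b)) (m + 1) by
        rw [ih']; ring]
    have h := fibPoly_add_two (a + b) (-(a * b)) m
    linear_combination (-(a * b)) * ih - (-(a * b)) * h

theorem fibPoly_two_mul {R : Type*} [CommRing R] (s q : R) (n : ℕ) :
    fibPoly s q (2 * n) = ∑ j ∈ Finset.range (n + 1),
      ((2 * n - j).choose j : R) * q ^ j * (s ^ 2) ^ (n - j) := by
  unfold fibPoly
  rw [← Finset.Nat.sum_antidiagonal_swap, Finset.Nat.sum_antidiagonal_eq_sum_range_succ_mk]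
  symm
  apply Finset.sum_subset_zero_on_sdiff
  · intro j
    simp only [Finset.mem_range]
    omega
  · intro j hj
    simp only [Finset.mem_sdiff, Finset.mem_range] at hj
    simp [Nat.choose_eq_zero_of_lt (show 2 * n - j < j by omega)]
  · intro j hj
    rw [Finset.mem_range] at hj
    simp only [Prod.swap]
    rw [← pow_mul, show 2 * (n - j) = 2 * n - j - j by omega]

theorem sum_range_two_mul_add_one {M : Type*} [AddCommMonoid M] (f : ℕ → M) (n : ℕ) :
    ∑ k ∈ Finset.range (2 * n + 1), f k =
      ∑ j ∈ Finset.range (n + 1), f (2 * j) + ∑ j ∈ Finset.range n, f (2 * j + 1) := by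
  induction n with
  | zero => simp
  | succ n ih =>
    rw [show 2 * (n + 1) + 1 = 2 * n + 1 + 1 + 1 by ring, Finset.sum_range_succ,
      Finset.sum_range_succ, ih, Finset.sum_range_succ _ (n + 1),
      Finset.sum_range_succ (fun j => f (2 * j + 1)) n, show 2 * (n + 1) = 2 * n + 1 + 1 by ring]
    abel

theorem two_mul_Pm_two_mul (n : ℕ) (y : ℝ) :
    2 * (Pm (2 * n) y : ℂ) = (Complex.I + y) ^ (2 * n) + (Complex.I - y) ^ (2 * n) := by
  have h : (Complex.I - y) ^ (2 * n) = (-Complex.I + y) ^ (2 * n) := by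
    rw [← (even_two_mul n).neg_pow]
    ring
  rw [h, add_pow, add_pow, sum_range_two_mul_add_one, sum_range_two_mul_add_one]
  simp only [pow_succ _ (2 * _), pow_mul, neg_sq, Complex.I_sq, mul_neg, neg_mul,
    Finset.sum_neg_distrib]
  rw [Pm, Nat.mul_div_cancel_left n two_pos]
  push_cast
  rw [Finset.sum_congr rfl fun j _ => mul_right_comm ((-1 : ℂ) ^ j) _ _]
  ring

theorem two_mul_div_mul_choose {K : Type*} [Field K] [CharZero K] (N k : ℕ) :
    ((N + k + 2 : ℕ) : K) / ((N + 1 : ℕ) : K) * ((N + 1).choose (k + 1)) =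
      (N + 1).choose (k + 1) + N.choose k := by
  have h : ((N : K) + 1) * N.choose k = (N + 1).choose (k + 1) * (k + 1) := by
    exact_mod_cast Nat.add_one_mul_choose_eq N k
  have hN : (N : K) + 1 ≠ 0 := by exact_mod_cast N.succ_ne_zero
  push_cast
  field_simp
  linear_combination -h

/-- For `α ≥ 1`, as an identity in the real variable `y`:
`P_{2α}(y) = Σ_{β=0}^{α} (−1)^{α−β} (α/(2α−β)) 2^{2(α−β)} C(2α−β, β) (1+y²)^β`. -/
theorem stmt13 (α : ℕ) (hα : 0 < α) (y : ℝ) :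
    Pm (2 * α) y =
      ∑ β ∈ Finset.range (α + 1),
        (-1 : ℝ) ^ (α - β) * ((α : ℝ) / ((2 * α - β : ℕ) : ℝ)) *
          2 ^ (2 * (α - β)) * ((2 * α - β).choose β) * (1 + y ^ 2) ^ β := by
  obtain ⟨n, rfl⟩ := Nat.exists_eq_succ_of_ne_zero hα.ne'
  rw [Nat.succ_eq_add_one]
  apply Complex.ofReal_injective
  apply mul_left_cancel₀ (two_ne_zero (α := ℂ))
  rw [two_mul_Pm_two_mul, mul_add, mul_one, pow_add_pow_eq_fibPoly,
    show 2 * n + 2 = 2 * (n + 1) by ring, fibPoly_two_mul, fibPoly_two_mul]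
  have hq : -((Complex.I + y) * (Complex.I - y)) = 1 + (y : ℂ) ^ 2 := by
    linear_combination -Complex.I_sq
  have hs : (Complex.I + y + (Complex.I - y)) ^ 2 = -1 * 2 ^ 2 := by
    linear_combination 4 * Complex.I_sq
  rw [hq, hs, Complex.ofReal_sum, Finset.sum_range_succ' _ (n + 1),
    Finset.sum_range_succ' _ (n + 1), mul_add (2 : ℂ), Finset.mul_sum, Finset.mul_sum,
    add_right_comm, ← Finset.sum_add_distrib]
  congr 1
  · refine Finset.sum_congr rfl fun k hk => ?_
    rw [Finset.mem_range] at hk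
    have h := two_mul_div_mul_choose (K := ℂ) (2 * n - k) k
    rw [show 2 * n - k + k + 2 = 2 * (n + 1) by omega] at h
    rw [show 2 * (n + 1) - (k + 1) = 2 * n - k + 1 by omega, Nat.add_sub_add_right, pow_mul,
      mul_pow]
    push_cast at h ⊢
    linear_combination -(-1) ^ (n - k) * (2 ^ 2) ^ (n - k) * (1 + (y : ℂ) ^ 2) ^ (k + 1) * h
  · have hn : (n : ℂ) + 1 ≠ 0 := by exact_mod_cast n.succ_ne_zero
    simp only [Nat.sub_zero, Nat.choose_zero_right, pow_zero, pow_mul, mul_pow]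
    push_cast
    field_simp
end

section
/- Let α and β be nonnegative integers with α ≥ 1 and β ≤ α. Then (2α − β) · Σ_{j=0}^{α−β} binom(2α, 2j) · binom(α−j, β) = α · binom(2α−β, β) · 2^{2(α−β)}; equivalently, Σ_{j=0}^{α−β} binom(2α, 2j) binom(α−j, β) = (α/(2α−β)) binom(2α−β, β) 2^{2(α−β)}. -/
/-- `∑ i ≤ N, C(n, 2i) C(i, b)`: the coefficient of `y ^ b` in the even part of `(1 + x) ^ n`,
where `x ^ 2 = 1 + y`. -/
def evenChooseSum (N n b : ℕ) : ℕ :=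
  ∑ i ∈ Finset.range (N + 1), n.choose (2 * i) * i.choose b

/-- `∑ i < N, C(n, 2i+1) C(i, b)`: the coefficient of `y ^ b` in the odd part of `(1 + x) ^ n`
divided by `x`, where `x ^ 2 = 1 + y`. -/
def oddChooseSum (N n b : ℕ) : ℕ :=
  ∑ i ∈ Finset.range N, n.choose (2 * i + 1) * i.choose b

theorem oddChooseSum_succ {N n : ℕ} (h : n < 2 * N) (b : ℕ) :
    oddChooseSum N (n + 1) b = evenChooseSum N n b + oddChooseSum N n b := by
  unfold oddChooseSum evenChooseSum
  rw [Finset.sum_range_succ, Nat.choose_eq_zero_of_lt h, zero_mul, add_zero,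
    ← Finset.sum_add_distrib]
  refine Finset.sum_congr rfl fun i _ => ?_
  rw [Nat.choose_succ_succ', add_mul]

theorem evenChooseSum_succ_zero (N n : ℕ) :
    evenChooseSum N (n + 1) 0 = evenChooseSum N n 0 + oddChooseSum N n 0 := by
  unfold oddChooseSum evenChooseSum
  rw [Finset.sum_range_succ', Finset.sum_range_succ' _ N]
  simp only [Nat.choose_zero_right, mul_one, mul_add, Nat.choose_succ_succ' n,
    Finset.sum_add_distrib, mul_zero]
  ring

theorem evenChooseSum_succ_succ (N n b : ℕ) :
    evenChooseSum N (n + 1) (b + 1) =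
      evenChooseSum N n (b + 1) + oddChooseSum N n b + oddChooseSum N n (b + 1) := by
  unfold oddChooseSum evenChooseSum
  rw [Finset.sum_range_succ', Finset.sum_range_succ' _ N]
  simp only [Nat.choose_zero_succ, mul_zero, add_zero, ← Finset.sum_add_distrib]
  refine Finset.sum_congr rfl fun i _ => ?_
  rw [show 2 * (i + 1) = 2 * i + 1 + 1 by ring, Nat.choose_succ_succ' n,
    Nat.choose_succ_succ' i]
  ring

theorem evenChooseSum_succ_zero_eq {N n : ℕ} (h : n < 2 * N) :
    evenChooseSum N (n + 1) 0 = oddChooseSum N (n + 1) 0 := by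
  rw [oddChooseSum_succ h, evenChooseSum_succ_zero]

theorem evenChooseSum_succ_succ_eq {N n : ℕ} (h : n < 2 * N) (b : ℕ) :
    evenChooseSum N (n + 1) (b + 1) =
      oddChooseSum N (n + 1) (b + 1) + oddChooseSum N n b := by
  rw [oddChooseSum_succ h, evenChooseSum_succ_succ]
  ring

theorem oddChooseSum_one {N : ℕ} (hN : 0 < N) (b : ℕ) :
    oddChooseSum N 1 b = Nat.choose 0 b := by
  unfold oddChooseSum
  rw [Finset.sum_eq_single_of_mem 0 (Finset.mem_range.2 hN)]
  · simp
  · intro i _ hi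
    rw [Nat.choose_eq_zero_of_lt (by omega), zero_mul]

theorem four_pow_mul_oddChooseSum {N : ℕ} (n : ℕ) (h : n < 2 * N) (b : ℕ) :
    4 ^ b * oddChooseSum N (n + 1) b = (n - b).choose b * 2 ^ n := by
  induction n using Nat.strong_induction_on generalizing b with
  | _ n ih =>
    rcases n with _ | n
    · rw [oddChooseSum_one (by omega)]
      cases b <;> simp
    rw [oddChooseSum_succ h]
    have ih₁ := ih n (by omega) (by omega)
    rcases b with _ | b
    · rw [evenChooseSum_succ_zero_eq (by omega)]
      have := ih₁ 0
      simp only [pow_zero, one_mul, Nat.choose_zero_right] at this ⊢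
      rw [this]
      ring
    · rw [evenChooseSum_succ_succ_eq (by omega)]
      have h₁ := ih₁ (b + 1)
      rcases n with _ | n
      · have h₀ : oddChooseSum N 0 b = 0 := by simp [oddChooseSum]
        rw [h₀, add_zero, mul_add, h₁]
        simp
      · have h₂ := ih n (by omega) (by omega) b
        rw [Nat.add_sub_add_right] at h₁ ⊢
        rcases le_or_gt b n with hb | hb
        · rw [show n + 1 - b = n - b + 1 by omega, Nat.choose_succ_succ']
          linear_combination 2 * h₁ + 4 * h₂
        · rw [Nat.choose_eq_zero_of_lt (by omega)] at h₁ h₂ ⊢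
          linear_combination 2 * h₁ + 4 * h₂

theorem sum_range_choose_mul_choose_sub {α β : ℕ} (hβ : β ≤ α) :
    ∑ j ∈ Finset.range (α - β + 1), (2 * α).choose (2 * j) * (α - j).choose β =
      evenChooseSum α (2 * α) β := by
  unfold evenChooseSum
  rw [← Finset.sum_range_reflect _ (α + 1)]
  refine Finset.sum_subset_zero_on_sdiff (Finset.range_mono (by omega)) ?_ ?_
  · intro j hj
    simp only [Finset.mem_sdiff, Finset.mem_range] at hj
    rw [Nat.choose_eq_zero_of_lt (n := α + 1 - 1 - j) (by omega), mul_zero]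
  · intro j hj
    rw [Finset.mem_range] at hj
    rw [show α + 1 - 1 - j = α - j by omega,
      Nat.choose_symm_of_eq_add (show 2 * α = 2 * j + 2 * (α - j) by omega)]

/-- For `α ≥ 1` and `β ≤ α`:
`(2α−β) Σ_{j=0}^{α−β} C(2α,2j) C(α−j,β) = α C(2α−β,β) 2^{2(α−β)}`, equivalently
`Σ_{j=0}^{α−β} C(2α,2j) C(α−j,β) = (α/(2α−β)) C(2α−β,β) 2^{2(α−β)}`. -/
theorem stmt14 (α β : ℕ) (hα : 1 ≤ α) (hβ : β ≤ α) :
    (2 * α - β) *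
        ∑ j ∈ Finset.range (α - β + 1), (2 * α).choose (2 * j) * (α - j).choose β =
      α * (2 * α - β).choose β * 2 ^ (2 * (α - β)) := by
  rw [sum_range_choose_mul_choose_sub hβ]
  obtain ⟨a, rfl⟩ : ∃ a, α = a + 1 := ⟨α - 1, by omega⟩
  have hlt : 2 * a + 1 < 2 * (a + 1) := by omega
  rw [show evenChooseSum (a + 1) (2 * (a + 1)) β = evenChooseSum (a + 1) (2 * a + 1 + 1) β from rfl]
  have h₁ := four_pow_mul_oddChooseSum (2 * a + 1) hlt β
  rcases β with _ | b
  · rw [evenChooseSum_succ_zero_eq hlt]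
    simp only [pow_zero, one_mul, Nat.choose_zero_right, Nat.sub_zero] at h₁ ⊢
    rw [h₁]
    ring
  · rw [evenChooseSum_succ_succ_eq hlt]
    have h₂ := four_pow_mul_oddChooseSum (N := a + 1) (2 * a) (by omega) b
    obtain ⟨d, rfl⟩ : ∃ d, a = b + d := ⟨a - b, by omega⟩
    rw [show 2 * (b + d) + 1 - (b + 1) = b + 2 * d by omega] at h₁
    rw [show 2 * (b + d) - b = b + 2 * d by omega] at h₂
    rw [show 2 * (b + d + 1) - (b + 1) = b + 2 * d + 1 by omega,
      show b + d + 1 - (b + 1) = d by omega]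
    have h₃ := Nat.add_one_mul_choose_eq (b + 2 * d) b
    have h₄ := Nat.choose_succ_succ' (b + 2 * d) b
    refine Nat.eq_of_mul_eq_mul_left (show 0 < 4 ^ (b + 1) by positivity) ?_
    have hpow : (4 : ℕ) ^ (b + 1) * 2 ^ (2 * d) = 4 * 2 ^ (2 * (b + d)) := by
      rw [show (4 : ℕ) = 2 ^ 2 by rfl, ← pow_mul, ← pow_add, ← pow_add]
      ring_nf
    have key : (b + 2 * d + 1) *
        (2 * (b + 2 * d).choose (b + 1) + 4 * (b + 2 * d).choose b) =
        4 * (b + d + 1) * (b + 2 * d + 1).choose (b + 1) := by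
      rw [h₄] at h₃ ⊢
      linear_combination 2 * h₃
    linear_combination (b + 2 * d + 1) * h₁ + 4 * (b + 2 * d + 1) * h₂ +
      2 ^ (2 * (b + d)) * key - (b + d + 1) * (b + 2 * d + 1).choose (b + 1) * hpow
end

section
/- Let x be a real number and t a real number with |t| < 1. Then sin(x · arctan t) · (1 + t²)^{−x/2} = Σ_{k=0}^{∞} ((−1)^k (x)_{2k+1} / (2k+1)!) · t^{2k+1}, where the series on the right converges for |t| < 1. -/
/-- The binomial series of `1 / (1 - z) ^ x`, written with rising factorials. -/
theorem hasSum_ascPochhammer_one_div_one_sub_cpow (x : ℝ) {z : ℂ} (hz : ‖z‖ < 1) :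
    HasSum (fun n : ℕ => (((ascPochhammer ℝ n).eval x / (Nat.factorial n) : ℝ) : ℂ) * z ^ n)
      (1 / (1 - z) ^ (x : ℂ)) := by
  have h := (Complex.one_div_one_sub_cpow_hasFPowerSeriesOnBall_zero (x : ℂ)).hasSum
    (y := z) (by simpa [enorm_eq_nnnorm, ← NNReal.coe_lt_coe] using hz)
  rw [zero_add] at h
  refine h.congr_fun fun n => ?_
  have hfac : (Nat.factorial n : ℂ) ≠ 0 := by exact_mod_cast n.factorial_ne_zero
  have hchoose := Ring.factorial_nsmul_multichoose_eq_ascPochhammer (x : ℂ) n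
  rw [Polynomial.ascPochhammer_smeval_eq_eval, Ring.multichoose_eq, nsmul_eq_mul] at hchoose
  have hcast : (((ascPochhammer ℝ n).eval x : ℝ) : ℂ) = (ascPochhammer ℂ n).eval (x : ℂ) := by
    rw [← ascPochhammer_map Complex.ofRealHom, Polynomial.eval_map, ← Complex.ofRealHom_eq_coe,
      ← Complex.ofRealHom_eq_coe, Polynomial.eval₂_hom]
  rw [Complex.ofReal_div, hcast, ← hchoose, Complex.ofReal_natCast,
    mul_div_cancel_left₀ _ hfac]
  simp [mul_comm]

theorem norm_one_sub_ofReal_mul_I (t : ℝ) : ‖1 - (t : ℂ) * Complex.I‖ = √(1 + t ^ 2) := by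
  rw [Complex.norm_def]
  congr 1
  simp [Complex.normSq_apply]
  ring

theorem arg_one_sub_ofReal_mul_I (t : ℝ) :
    Complex.arg (1 - (t : ℂ) * Complex.I) = -Real.arctan t := by
  rw [Complex.arg_of_re_nonneg (by simp), norm_one_sub_ofReal_mul_I, Real.arctan_eq_arcsin,
    ← Real.arcsin_neg]
  congr 1
  simp [neg_div]

theorem one_div_one_sub_ofReal_mul_I_cpow_im (x t : ℝ) :
    (1 / (1 - (t : ℂ) * Complex.I) ^ (x : ℂ)).im =
      Real.sin (x * Real.arctan t) * (1 + t ^ 2) ^ (-(x / 2)) := by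
  have hne : 1 - (t : ℂ) * Complex.I ≠ 0 := fun h => by
    simpa using congrArg Complex.re h
  have hpos : 0 < 1 + t ^ 2 := by positivity
  rw [one_div, ← Complex.cpow_neg, Complex.cpow_def_of_ne_zero hne, Complex.exp_im, mul_comm,
    Real.rpow_def_of_pos hpos]
  simp only [Complex.mul_re, Complex.mul_im, Complex.log_re, Complex.log_im, Complex.neg_re,
    Complex.neg_im, Complex.ofReal_re, Complex.ofReal_im, norm_one_sub_ofReal_mul_I,
    arg_one_sub_ofReal_mul_I, Real.log_sqrt hpos.le]
  congr 2 <;> ring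


/-- For real `x` and `|t| < 1`, the series
`Σ_{k≥0} ((−1)^k (x)_{2k+1}/(2k+1)!) t^{2k+1}` converges to
`sin(x arctan t) (1+t²)^{−x/2}`, where `(x)_n` is the Pochhammer (rising factorial)
symbol, realized in Mathlib as `(ascPochhammer ℝ n).eval x`. -/
theorem stmt15 (x t : ℝ) (ht : |t| < 1) :
    HasSum
      (fun k : ℕ =>
        (-1 : ℝ) ^ k * (ascPochhammer ℝ (2 * k + 1)).eval x /
          (Nat.factorial (2 * k + 1)) * t ^ (2 * k + 1))
      (Real.sin (x * Real.arctan t) * (1 + t ^ 2) ^ (-(x / 2))) := by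
  have h := Complex.hasSum_im (hasSum_ascPochhammer_one_div_one_sub_cpow x
    (z := (t : ℂ) * Complex.I) (by simpa using ht))
  rw [one_div_one_sub_ofReal_mul_I_cpow_im] at h
  have hodd : Function.Injective fun k : ℕ => 2 * k + 1 := fun a b hab => by
    simpa using hab
  rw [← hodd.hasSum_iff] at h
  · refine h.congr_fun fun k => ?_
    have hI : ((t : ℂ) * Complex.I) ^ (2 * k + 1) =
        (((-1) ^ k * t ^ (2 * k + 1) : ℝ) : ℂ) * Complex.I := by
      rw [mul_pow, pow_succ Complex.I, pow_mul Complex.I, Complex.I_sq]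
      push_cast
      ring
    simp only [Function.comp_apply]
    rw [hI, Complex.im_ofReal_mul, Complex.im_ofReal_mul, Complex.I_im]
    ring
  · intro n hn
    obtain ⟨m, rfl⟩ : Even n := by
      rw [← Nat.not_odd_iff_even]
      rintro ⟨k, rfl⟩
      exact hn ⟨k, rfl⟩
    have hI : ((t : ℂ) * Complex.I) ^ (m + m) = (((-1) ^ m * t ^ (m + m) : ℝ) : ℂ) := by
      rw [mul_pow, ← two_mul, pow_mul Complex.I, Complex.I_sq]
      push_cast
      ring
    rw [hI, ← Complex.ofReal_mul, Complex.ofReal_im]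
end

section
/- Let a_0, a_1, a_2 be real numbers with a_0 ≠ 0 and a_1² < 4 a_0 a_2. Then ∫_{−∞}^{∞} dx/(a_0 x² + a_1 x + a_2) = ∫_{−∞}^{∞} 2(a_0 + a_2) dx / ( 4 a_0 a_2 x² + 2 a_1 (a_2 − a_0) x + ((a_0 + a_2)² − a_1²) ); that is, the integral ∫_{−∞}^{∞} dx/(a_0 x² + a_1 x + a_2) is invariant under the transformation a_0 ↦ 2a_0a_2/(a_0+a_2), a_1 ↦ a_1(a_2−a_0)/(a_0+a_2), a_2 ↦ ((a_0+a_2)² − a_1²)/(2(a_0+a_2)). -/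
/-- The integral over the real line of the reciprocal of a real quadratic `a x² + b x + c`
whose discriminant is `-s² < 0`. -/
lemma integral_inv_quadratic {a b c s : ℝ} (ha : a ≠ 0) (hs : 0 < s)
    (hD : s ^ 2 = 4 * a * c - b ^ 2) :
    ∫ x : ℝ, 1 / (a * x ^ 2 + b * x + c) = 2 * Real.pi * a / (|a| * s) := by
  have hs' : s ≠ 0 := hs.ne'
  have habs : |a| ≠ 0 := abs_ne_zero.mpr ha
  have hform : ∀ x : ℝ, 1 / (a * x ^ 2 + b * x + c) =
      4 * a / s ^ 2 * (1 + (2 * a / s * (x + b / (2 * a))) ^ 2)⁻¹ := by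
    intro x
    have hquad : a * x ^ 2 + b * x + c =
        s ^ 2 / (4 * a) * (1 + (2 * a / s * (x + b / (2 * a))) ^ 2) := by
      field_simp
      linear_combination -hD
    rw [hquad, one_div, mul_inv, inv_div]
  simp_rw [hform]
  rw [MeasureTheory.integral_const_mul,
    MeasureTheory.integral_add_right_eq_self
      (fun x : ℝ => (1 + (2 * a / s * x) ^ 2)⁻¹) (b / (2 * a)),
    MeasureTheory.Measure.integral_comp_mul_left (fun x : ℝ => (1 + x ^ 2)⁻¹),
    integral_univ_inv_one_add_sq, inv_div, abs_div, abs_mul, abs_two, abs_of_pos hs,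
    smul_eq_mul]
  field_simp
  ring

/-- For `a₀ ≠ 0` and `a₁² < 4a₀a₂` (so the quadratic has no real zeros):
`∫_{−∞}^{∞} dx/(a₀x²+a₁x+a₂)
   = ∫_{−∞}^{∞} 2(a₀+a₂) dx/(4a₀a₂x² + 2a₁(a₂−a₀)x + ((a₀+a₂)²−a₁²))`,
i.e. the integral is invariant under the rational Landen transformation
`a₀ ↦ 2a₀a₂/(a₀+a₂)`, `a₁ ↦ a₁(a₂−a₀)/(a₀+a₂)`, `a₂ ↦ ((a₀+a₂)²−a₁²)/(2(a₀+a₂))`. -/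
theorem stmt18 (a₀ a₁ a₂ : ℝ) (h0 : a₀ ≠ 0) (h : a₁ ^ 2 < 4 * a₀ * a₂) :
    (∫ x : ℝ, 1 / (a₀ * x ^ 2 + a₁ * x + a₂)) =
      ∫ x : ℝ, (2 * (a₀ + a₂)) /
        (4 * a₀ * a₂ * x ^ 2 + 2 * a₁ * (a₂ - a₀) * x + ((a₀ + a₂) ^ 2 - a₁ ^ 2)) := by
  have hpos : 0 < a₀ * a₂ := by nlinarith [sq_nonneg a₁]
  have h2 : a₂ ≠ 0 := right_ne_zero_of_mul hpos.ne'
  have hsum : a₀ + a₂ ≠ 0 := by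
    intro H
    nlinarith [sq_nonneg (a₀ + a₂), sq_nonneg a₀, sq_nonneg a₂]
  have hsgn : a₀ / |a₀| = (a₀ + a₂) / |a₀ + a₂| := by
    rcases mul_pos_iff.mp hpos with ⟨h₀, h₂⟩ | ⟨h₀, h₂⟩
    · rw [abs_of_pos h₀, abs_of_pos (add_pos h₀ h₂), div_self h0, div_self hsum]
    · rw [abs_of_neg h₀, abs_of_neg (add_neg h₀ h₂), div_neg, div_neg, div_self h0,
        div_self hsum]
  obtain ⟨s, hs, hD⟩ : ∃ s : ℝ, 0 < s ∧ s ^ 2 = 4 * a₀ * a₂ - a₁ ^ 2 :=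
    ⟨√(4 * a₀ * a₂ - a₁ ^ 2), Real.sqrt_pos.mpr (by linarith), Real.sq_sqrt (by linarith)⟩
  have hlead : 0 < 4 * a₀ * a₂ := by linarith
  have habs : |a₀ + a₂| ≠ 0 := abs_ne_zero.mpr hsum
  have hD' : (2 * |a₀ + a₂| * s) ^ 2 = 4 * (4 * a₀ * a₂) * ((a₀ + a₂) ^ 2 - a₁ ^ 2) -
      (2 * a₁ * (a₂ - a₀)) ^ 2 := by
    rw [mul_pow, mul_pow, sq_abs, hD]
    ring
  simp_rw [div_eq_mul_one_div (2 * (a₀ + a₂))]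
  rw [MeasureTheory.integral_const_mul, integral_inv_quadratic h0 hs hD,
    integral_inv_quadratic hlead.ne' (by positivity) hD', abs_of_pos hlead]
  calc 2 * Real.pi * a₀ / (|a₀| * s) = 2 * Real.pi / s * (a₀ / |a₀|) := by
        rw [div_mul_div_comm, mul_comm s]
    _ = _ := by
        rw [hsgn]
        field_simp
end
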